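/- arXiv:2507.06599 — 6 statements merged into one kernel-verified Lean document; each statement's English description precedes it below -/
import Mathlib

section
/- There exists a countable group G that is not finitely generated, together with a finite alphabet and an infinite minimal sofic subshift over G. -/
/-- The shift action of `G` on `A^G`: `(g • x) h = x (g⁻¹ h)`. -/
def shiftAct (G : Type*) [Group G] (A : Type*) (g : G) (x : G → A) : G → A :=
  fun h => x (g⁻¹ * h)

/-- A subshift: a closed, shift-invariant subset of `A^G` (with `A` carrying the
discrete topology and `A^G` the product topology). -/
def IsSubshift (G : Type*) [Group G] (A : Type*) [TopologicalSpace A]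
    (X : Set (G → A)) : Prop :=
  IsClosed X ∧ ∀ (g : G) (x : G → A), x ∈ X → shiftAct G A g x ∈ X

/-- A subshift of finite type: the set of points none of whose translates meets a
fixed clopen set `C`. -/
def IsSFT (G : Type*) [Group G] (A : Type*) [TopologicalSpace A]
    (X : Set (G → A)) : Prop :=
  ∃ C : Set (G → A), IsClopen C ∧ X = {x : G → A | ∀ g : G, shiftAct G A g x ∉ C}

/-- A sofic shift: a subshift which is the image of an SFT (over some finite
alphabet `B`) under a continuous shift-commuting surjection. -/
def IsSoficShift (G : Type*) [Group G] (A : Type*) [TopologicalSpace A]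
    (X : Set (G → A)) : Prop :=
  IsSubshift G A X ∧
    ∃ (B : Type) (_ : Fintype B) (_ : TopologicalSpace B) (_ : DiscreteTopology B)
      (Y : Set (G → B)) (f : (G → B) → (G → A)),
        IsSFT G B Y ∧ ContinuousOn f Y ∧
        (∀ y ∈ Y, ∀ g : G, f (shiftAct G B g y) = shiftAct G A g (f y)) ∧
        f '' Y = X

/-- A subshift is minimal if it has no proper nonempty closed invariant subset. -/
def IsMinimalSubshift (G : Type*) [Group G] (A : Type*) [TopologicalSpace A]
    (X : Set (G → A)) : Prop :=
  IsSubshift G A X ∧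
    ∀ Y : Set (G → A), Y ⊆ X → IsSubshift G A Y → Y = ∅ ∨ Y = X

/-- Configurations on `G` that transform under right multiplication by elements of `H`
according to `ρ`. -/
def cosetShift {G F : Type} [Group G] {H : Subgroup G} (ρ : H →* Equiv.Perm F) :
    Set (G → F) :=
  {x | ∀ (g : G) (k : H), x (g * k) = ρ k⁻¹ (x g)}

theorem isSFT_cosetShift {G F : Type} [Group G] [TopologicalSpace F] [DiscreteTopology F]
    {H : Subgroup G} (hH : H.FG) (ρ : H →* Equiv.Perm F) : IsSFT G F (cosetShift ρ) := by
  have hfg : Group.FG H := (Group.fg_iff_subgroup_fg H).2 hH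
  obtain ⟨S, hS, hfin⟩ := Group.fg_iff.1 hfg
  refine ⟨⋃ k ∈ S, {x | x k ≠ ρ k⁻¹ (x 1)}, ?_, ?_⟩
  · refine hfin.isClopen_biUnion fun k _ => ?_
    have hc : Continuous fun x : G → F => (x k, x 1) := by fun_prop
    exact (isClopen_discrete {p : F × F | p.1 ≠ ρ k⁻¹ p.2}).preimage hc
  · ext x
    simp only [cosetShift, Set.mem_ofPred_eq, Set.mem_iUnion, not_exists, not_not, shiftAct,
      mul_one, exists_prop, not_and]
    constructor
    · intro hx g k _
      exact hx _ _
    · intro hx g k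
      have hk : k ∈ Subgroup.closure S := hS ▸ Subgroup.mem_top k
      induction hk using Subgroup.closure_induction generalizing g with
      | mem k hk => simpa using hx g⁻¹ k hk
      | one => simp
      | mul a b _ _ ha hb =>
        rw [Subgroup.coe_mul, ← mul_assoc, hb, ha]
        simp
      | inv a _ ha =>
        have := ha (g * (a : G)⁻¹)
        simp only [inv_mul_cancel_right] at this
        rw [Subgroup.coe_inv, this]
        simp

theorem isSubshift_of_isSFT {G A : Type} [Group G] [TopologicalSpace A]
    {X : Set (G → A)} (hX : IsSFT G A X) : IsSubshift G A X := by
  obtain ⟨C, hC, rfl⟩ := hX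
  constructor
  · have : {x : G → A | ∀ g : G, shiftAct G A g x ∉ C} =
        ⋂ g : G, (shiftAct G A g) ⁻¹' Cᶜ := by
      ext x; simp
    rw [this]
    refine isClosed_iInter fun g => hC.compl.isClosed.preimage ?_
    unfold shiftAct
    fun_prop
  · intro g x hx k
    have e : shiftAct G A k (shiftAct G A g x) = shiftAct G A (k * g) x := by
      funext h
      simp [shiftAct, mul_assoc]
    rw [e]
    exact hx (k * g)

/-- If for any two points of `F` some `β ∈ H` carries one to the other while all conjugates of
`β` by elements outside `H` act trivially, then the coset shift is minimal. -/
theorem isMinimalSubshift_cosetShift {G F : Type} [Group G] [TopologicalSpace F]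
    [DiscreteTopology F] {H : Subgroup G} (hH : H.FG) (ρ : H →* Equiv.Perm F)
    (hρ : ∀ a b : F, ∃ β : H, ρ β a = b ∧
      ∀ t : G, t ∉ H → ∃ h : t⁻¹ * β * t ∈ H, ρ ⟨_, h⟩ = 1) :
    IsMinimalSubshift G F (cosetShift ρ) := by
  classical
  refine ⟨isSubshift_of_isSFT (isSFT_cosetShift hH ρ), fun Y hYX hY => ?_⟩
  rcases Y.eq_empty_or_nonempty with h | ⟨y, hy⟩
  · exact Or.inl h
  refine Or.inr (hYX.antisymm fun z hz => ?_)
  have hyX := hYX hy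
  have key : ∀ T : Finset G, ∃ g : G, ∀ t ∈ T, y (g * t) = z t := by
    intro T
    induction T using Finset.induction_on with
    | empty => exact ⟨1, by simp⟩
    | insert s T _ ih =>
      obtain ⟨g, hg⟩ := ih
      by_cases hs : ∃ t ∈ T, t⁻¹ * s ∈ H
      · obtain ⟨t, ht, hts⟩ := hs
        refine ⟨g, fun r hr => ?_⟩
        rcases Finset.mem_insert.1 hr with rfl | hr
        · have h1 := hyX (g * t) ⟨_, hts⟩
          have h2 := hz t ⟨_, hts⟩
          simp only [mul_assoc, mul_inv_cancel_left] at h1 h2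
          rw [h1, h2, hg t ht]
        · exact hg r hr
      · push Not at hs
        obtain ⟨β, hβ, hβt⟩ := hρ (z s) (y (g * s))
        refine ⟨g * (s * β * s⁻¹), fun r hr => ?_⟩
        rcases Finset.mem_insert.1 hr with rfl | hr
        · have h1 := hyX (g * r) β
          have e : g * (r * β * r⁻¹) * r = g * r * β := by group
          rw [e, h1, ← hβ]
          simp
        · have hn : s⁻¹ * r ∉ H := fun h => hs r hr (by simpa using H.inv_mem h)
          obtain ⟨h, h'⟩ := hβt _ hn
          have h1 := hyX (g * r) ⟨_, h⟩
          have e : g * (s * β * s⁻¹) * r = g * r * ((s⁻¹ * r)⁻¹ * β * (s⁻¹ * r)) := by group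
          rw [e, h1, map_inv, h', ← hg r hr]
          simp
  have hmem : z ∈ closure Y := by
    rw [mem_closure_iff]
    intro o ho hzo
    obtain ⟨I, u, hu, hsub⟩ := isOpen_pi_iff.1 ho z hzo
    obtain ⟨g, hg⟩ := key I
    refine ⟨shiftAct G F g⁻¹ y, hsub fun t ht => ?_, hY.2 _ _ hy⟩
    have : shiftAct G F g⁻¹ y t = z t := by
      simpa [shiftAct] using hg t ht
    rw [this]
    exact (hu t ht).2
  rwa [hY.1.closure_eq] at hmem

theorem infinite_cosetShift {G F : Type} [Group G] [Nontrivial F] {H : Subgroup G}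
    [Infinite (G ⧸ H)] (ρ : H →* Equiv.Perm F) : (cosetShift ρ).Infinite := by
  let c : G → H := fun g => ⟨(Quotient.out (g : G ⧸ H))⁻¹ * g,
    QuotientGroup.eq.1 (Quotient.out_eq' (g : G ⧸ H))⟩
  have hc : ∀ (g : G) (k : H), c (g * k) = c g * k := by
    intro g k
    ext
    have : ((g * (k : G) : G) : G ⧸ H) = g := by simp
    simp [c, this, mul_assoc]
  let Φ : (G ⧸ H → F) → cosetShift ρ := fun f =>
    ⟨fun g => ρ (c g)⁻¹ (f g), fun g k => by
      have : ((g * (k : G) : G) : G ⧸ H) = g := by simp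
      simp [hc, this]⟩
  have hΦ : Function.Injective Φ := by
    intro f f' h
    funext q
    obtain ⟨g, rfl⟩ := QuotientGroup.mk_surjective q
    have := congrFun (congrArg Subtype.val h) g
    exact (ρ (c g)⁻¹).injective this
  exact Set.infinite_coe_iff.1 (Infinite.of_injective Φ hΦ)

theorem infinite_quotient_of_not_fg {G : Type} [Group G] (hG : ¬ Group.FG G) {H : Subgroup G}
    (hH : H.FG) : Infinite (G ⧸ H) := by
  by_contra hfin
  rw [not_infinite_iff_finite] at hfin
  obtain ⟨S, hS, hSf⟩ := (Subgroup.fg_iff H).1 hH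
  refine hG (Group.fg_iff.2 ⟨S ∪ Set.range (Quotient.out : G ⧸ H → G), ?_,
    hSf.union (Set.finite_range _)⟩)
  rw [eq_top_iff]
  intro g _
  have h1 : (Quotient.out (g : G ⧸ H))⁻¹ * g ∈ Subgroup.closure S := by
    rw [hS]
    exact QuotientGroup.eq.1 (Quotient.out_eq' (g : G ⧸ H))
  have h2 : Quotient.out (g : G ⧸ H) ∈
      Subgroup.closure (S ∪ Set.range (Quotient.out : G ⧸ H → G)) :=
    Subgroup.subset_closure (Or.inr ⟨_, rfl⟩)
  have h3 := Subgroup.closure_mono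
    (Set.subset_union_left (t := Set.range (Quotient.out : G ⧸ H → G))) h1
  have h4 := Subgroup.mul_mem _ h2 h3
  rwa [mul_inv_cancel_left] at h4

theorem exists_of_fg_subgroup {G F : Type} [Group G] (hG : ¬ Group.FG G) [Fintype F]
    [Nontrivial F] {H : Subgroup G} (hH : H.FG) (ρ : H →* Equiv.Perm F)
    (hρ : ∀ a b : F, ∃ β : H, ρ β a = b ∧
      ∀ t : G, t ∉ H → ∃ h : t⁻¹ * β * t ∈ H, ρ ⟨_, h⟩ = 1) :
    ∃ (A : Type) (_ : Fintype A) (_ : TopologicalSpace A) (_ : DiscreteTopology A)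
      (X : Set (G → A)), IsSoficShift G A X ∧ IsMinimalSubshift G A X ∧ X.Infinite := by
  let _ : TopologicalSpace F := ⊥
  have : DiscreteTopology F := ⟨rfl⟩
  have := infinite_quotient_of_not_fg hG hH
  have hsft := isSFT_cosetShift hH ρ
  exact ⟨F, inferInstance, inferInstance, inferInstance, cosetShift ρ,
    ⟨isSubshift_of_isSFT hsft, F, inferInstance, inferInstance, inferInstance, cosetShift ρ, id,
      hsft, continuousOn_id, fun _ _ _ => rfl, Set.image_id _⟩,
    isMinimalSubshift_cosetShift hH ρ hρ, infinite_cosetShift ρ⟩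

namespace BlockTower

open Equiv
open scoped commutatorElement

/-- The permutation of `ℕ` permuting the consecutive blocks of length `M` according to `p`. -/
def blk (M : ℕ) : Perm ℕ →* Perm ℕ :=
  MonoidHom.toHomPerm
    { toFun := fun p z => M * p (z / M) + z % M
      map_one' := by
        funext z
        exact Nat.div_add_mod z M
      map_mul' := by
        intro p q
        funext z
        change _ = M * p ((M * q (z / M) + z % M) / M) + (M * q (z / M) + z % M) % M
        rcases Nat.eq_zero_or_pos M with rfl | hM
        · simp
        · simp [Nat.mul_add_div hM, Nat.div_eq_of_lt (Nat.mod_lt z hM)] }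

theorem blk_apply {M : ℕ} (p : Perm ℕ) (z : ℕ) : blk M p z = M * p (z / M) + z % M := rfl

theorem div_mod_block {M b : ℕ} (hb : b < M) (d : ℕ) :
    (M * d + b) / M = d ∧ (M * d + b) % M = b := by
  constructor
  · rw [Nat.mul_add_div (by omega), Nat.div_eq_of_lt hb, add_zero]
  · rw [Nat.mul_add_mod, Nat.mod_eq_of_lt hb]

theorem blk_block {M b : ℕ} (p : Perm ℕ) (d : ℕ) (hb : b < M) :
    blk M p (M * d + b) = M * p d + b := by
  rw [blk_apply, (div_mod_block hb d).1, (div_mod_block hb d).2]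

theorem perm_ext_blocks {M : ℕ} (hM : 0 < M) {e e' : Perm ℕ}
    (h : ∀ d b, b < M → e (M * d + b) = e' (M * d + b)) : e = e' := by
  ext z
  rw [← Nat.div_add_mod z M]
  exact h _ _ (Nat.mod_lt _ hM)

/-- The permutations of `ℕ` supported on the initial segment of length `M`. -/
def supp (M : ℕ) : Subgroup (Perm ℕ) where
  carrier := {p | ∀ z, M ≤ z → p z = z}
  mul_mem' := by
    intro p q hp hq z hz
    rw [Perm.mul_apply, hq z hz, hp z hz]
  one_mem' := fun _ _ => rfl
  inv_mem' := by
    intro p hp z hz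
    rw [Perm.inv_eq_iff_eq, hp z hz]

theorem apply_lt_of_mem_supp {M z : ℕ} {p : Perm ℕ} (hp : p ∈ supp M) (hz : z < M) :
    p z < M := by
  by_contra h
  push Not at h
  have := p.injective (hp (p z) h)
  omega

theorem blk_mem_supp {M r : ℕ} {p : Perm ℕ} (hp : p ∈ supp r) : blk M p ∈ supp (M * r) := by
  intro z hz
  rcases Nat.eq_zero_or_pos M with rfl | hM
  · simp [blk_apply]
  · rw [blk_apply, hp _ ((Nat.le_div_iff_mul_le hM).2 (by rwa [mul_comm])), Nat.div_add_mod]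

/-- The copy on the `d`-th block of a permutation supported on the initial block. -/
def cp (M d : ℕ) (a : Perm ℕ) : Perm ℕ := MulAut.conj (blk M (swap 0 d)) a

theorem cp_zero (M : ℕ) (a : Perm ℕ) : cp M 0 a = a := by
  rw [cp, swap_self, ← Perm.one_def, map_one, map_one, MulAut.one_apply]

theorem cp_one (M d : ℕ) : cp M d 1 = 1 := by
  simp only [cp, map_one]

theorem cp_block_self {M b : ℕ} {a : Perm ℕ} (ha : a ∈ supp M) (d : ℕ) (hb : b < M) :
    cp M d a (M * d + b) = M * d + a b := by
  have h0 : a b < M := apply_lt_of_mem_supp ha hb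
  rw [cp, MulAut.conj_apply, ← map_inv, swap_inv, Perm.mul_apply, Perm.mul_apply,
    blk_block _ _ hb, swap_apply_right, mul_zero, zero_add]
  have := blk_block (swap 0 d) 0 h0
  rwa [mul_zero, zero_add, swap_apply_left] at this

theorem cp_block_of_ne {M b d d' : ℕ} {a : Perm ℕ} (ha : a ∈ supp M) (hd : d' ≠ d) (hb : b < M) :
    cp M d a (M * d' + b) = M * d' + b := by
  have h1 : swap 0 d d' ≠ 0 := by
    intro h
    rw [swap_apply_eq_iff, swap_apply_left] at h
    exact hd h
  have h2 : a (M * swap 0 d d' + b) = M * swap 0 d d' + b :=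
    ha _ (by nlinarith [Nat.pos_of_ne_zero h1])
  rw [cp, MulAut.conj_apply, ← map_inv, swap_inv, Perm.mul_apply, Perm.mul_apply,
    blk_block _ _ hb, h2, blk_block _ _ hb, swap_apply_self]

theorem cp_mem_supp {M r d : ℕ} {a : Perm ℕ} (ha : a ∈ supp M) (hd : d < r) :
    cp M d a ∈ supp (M * r) := by
  intro z hz
  rcases Nat.eq_zero_or_pos M with rfl | hM
  · have : a = 1 := by
      ext z
      exact ha z (Nat.zero_le z)
    rw [this, cp_one, Perm.one_apply]
  · have h1 : r ≤ z / M := (Nat.le_div_iff_mul_le hM).2 (by rwa [mul_comm])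
    have h2 := cp_block_of_ne ha (d := d) (d' := z / M) (by omega) (Nat.mod_lt z hM)
    rwa [Nat.div_add_mod] at h2

theorem blk_mul_cp {M d : ℕ} (hM : 0 < M) {a : Perm ℕ} (ha : a ∈ supp M) (p : Perm ℕ) :
    blk M p * cp M d a = cp M (p d) a * blk M p := by
  refine perm_ext_blocks hM fun d' b hb => ?_
  rw [Perm.mul_apply, Perm.mul_apply, blk_block _ _ hb]
  by_cases h : d' = d
  · subst h
    rw [cp_block_self ha _ hb, cp_block_self ha _ hb, blk_block _ _ (apply_lt_of_mem_supp ha hb)]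
  · rw [cp_block_of_ne ha h hb, cp_block_of_ne ha (by simpa using h) hb, blk_block _ _ hb]

theorem conj_blk_cp {M d : ℕ} (hM : 0 < M) {a : Perm ℕ} (ha : a ∈ supp M) (p : Perm ℕ) :
    blk M p * cp M d a * (blk M p)⁻¹ = cp M (p d) a := by
  rw [blk_mul_cp hM ha, mul_inv_cancel_right]

theorem commute_cp {M d d' : ℕ} (hM : 0 < M) {a a' : Perm ℕ} (ha : a ∈ supp M)
    (ha' : a' ∈ supp M) (hd : d ≠ d') : Commute (cp M d a) (cp M d' a') := by
  refine perm_ext_blocks hM fun x b hb => ?_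
  rw [Perm.mul_apply, Perm.mul_apply]
  by_cases h : x = d
  · subst h
    rw [cp_block_of_ne ha' hd hb, cp_block_self ha _ hb,
      cp_block_of_ne ha' hd (apply_lt_of_mem_supp ha hb)]
  · by_cases h' : x = d'
    · subst h'
      rw [cp_block_of_ne ha h hb, cp_block_self ha' _ hb,
        cp_block_of_ne ha h (apply_lt_of_mem_supp ha' hb)]
    · rw [cp_block_of_ne ha' h' hb, cp_block_of_ne ha h hb, cp_block_of_ne ha' h' hb]

/-- The even permutations of `{0, …, r - 1}`, as permutations of `ℕ`. -/
noncomputable def altNat (r : ℕ) : Subgroup (Perm ℕ) :=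
  (alternatingGroup (Fin r)).map (Perm.viaEmbeddingHom Fin.valEmbedding)

theorem altNat_le_supp (r : ℕ) : altNat r ≤ supp r := by
  rintro _ ⟨e, _, rfl⟩ z hz
  refine Perm.viaEmbedding_apply_of_notMem e _ z ?_
  rintro ⟨i, rfl⟩
  exact absurd i.2 (not_lt.2 hz)

theorem mem_altNat_fin {r : ℕ} (e : Perm (Fin r)) (he : Perm.sign e = 1) :
    Perm.viaEmbeddingHom Fin.valEmbedding e ∈ altNat r :=
  ⟨e, he, rfl⟩

theorem altNat_le_commutator {r : ℕ} (hr : 5 ≤ r) : altNat r ≤ ⁅altNat r, altNat r⁆ := by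
  have h := commutator_alternatingGroup_eq_top (α := Fin r) (by simpa using hr)
  have h2 : ⁅alternatingGroup (Fin r), alternatingGroup (Fin r)⁆ = alternatingGroup (Fin r) := by
    have := congrArg (Subgroup.map (alternatingGroup (Fin r)).subtype) h
    rwa [commutator_def, Subgroup.map_commutator, ← MonoidHom.range_eq_map,
      Subgroup.range_subtype] at this
  rw [altNat, ← Subgroup.map_commutator, h2]

/-- The wreath product of `A`, acting on blocks of length `M`, with the even permutations of the
first `r` blocks. -/
noncomputable def wreath (M r : ℕ) (A : Subgroup (Perm ℕ)) : Subgroup (Perm ℕ) :=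
  (altNat r).map (blk M) ⊔ ⨆ d : Fin r, A.map (MulAut.conj (blk M (swap 0 (d : ℕ)))).toMonoidHom

theorem blk_mem_wreath {M r : ℕ} (A : Subgroup (Perm ℕ)) {p : Perm ℕ} (hp : p ∈ altNat r) :
    blk M p ∈ wreath M r A :=
  Subgroup.mem_sup_left ⟨p, hp, rfl⟩

theorem cp_mem_wreath {M r d : ℕ} {A : Subgroup (Perm ℕ)} {a : Perm ℕ} (ha : a ∈ A) (hd : d < r) :
    cp M d a ∈ wreath M r A :=
  Subgroup.mem_sup_right (Subgroup.mem_iSup_of_mem (⟨d, hd⟩ : Fin r) ⟨a, ha, rfl⟩)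

theorem wreath_le {M r : ℕ} {A K : Subgroup (Perm ℕ)} (h1 : ∀ p ∈ altNat r, blk M p ∈ K)
    (h2 : ∀ d < r, ∀ a ∈ A, cp M d a ∈ K) : wreath M r A ≤ K := by
  refine sup_le ?_ (iSup_le fun d => ?_)
  · rintro _ ⟨p, hp, rfl⟩
    exact h1 p hp
  · rintro _ ⟨a, ha, rfl⟩
    exact h2 d d.2 a ha

theorem le_wreath {M r : ℕ} (A : Subgroup (Perm ℕ)) (hr : 0 < r) : A ≤ wreath M r A := by
  intro a ha
  rw [← cp_zero M a]
  exact cp_mem_wreath ha hr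

theorem wreath_le_supp {M r : ℕ} {A : Subgroup (Perm ℕ)} (hA : A ≤ supp M) :
    wreath M r A ≤ supp (M * r) :=
  wreath_le (fun _ hp => blk_mem_supp (altNat_le_supp r hp))
    fun _ hd _ ha => cp_mem_supp (hA ha) hd

theorem wreath_le_commutator {M r : ℕ} {A : Subgroup (Perm ℕ)} (hr : 5 ≤ r) (hA : A ≤ ⁅A, A⁆) :
    wreath M r A ≤ ⁅wreath M r A, wreath M r A⁆ := by
  refine sup_le ?_ (iSup_le fun d => ?_)
  · refine (Subgroup.map_mono (altNat_le_commutator hr)).trans ?_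
    rw [Subgroup.map_commutator]
    exact Subgroup.commutator_mono le_sup_left le_sup_left
  · refine (Subgroup.map_mono hA).trans ?_
    rw [Subgroup.map_commutator]
    have := (le_iSup (fun d : Fin r =>
      A.map (MulAut.conj (blk M (swap 0 (d : ℕ)))).toMonoidHom) d).trans
      (le_sup_right (a := (altNat r).map (blk M)))
    exact Subgroup.commutator_mono this this

/-- Normal form of the elements of a wreath product. -/
theorem exists_normalForm {M r : ℕ} {A : Subgroup (Perm ℕ)} (hA : A ≤ supp M)
    {e : Perm ℕ} (he : e ∈ wreath M r A) :
    ∃ p ∈ altNat r, ∃ f : ℕ → Perm ℕ, (∀ d, f d ∈ A) ∧ (∀ d, r ≤ d → f d = 1) ∧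
      ∀ d b, b < M → e (M * d + b) = M * p d + f d b := by
  let K : Subgroup (Perm ℕ) :=
    { carrier := {e | ∃ p ∈ altNat r, ∃ f : ℕ → Perm ℕ, (∀ d, f d ∈ A) ∧ (∀ d, r ≤ d → f d = 1) ∧
        ∀ d b, b < M → e (M * d + b) = M * p d + f d b}
      one_mem' := ⟨1, one_mem _, 1, fun _ => one_mem _, fun _ _ => rfl, fun _ _ _ => rfl⟩
      mul_mem' := by
        rintro e e' ⟨p, hp, f, hf, hf', h⟩ ⟨q, hq, g, hg, hg', h'⟩
        refine ⟨p * q, mul_mem hp hq, fun d => f (q d) * g d, fun d => mul_mem (hf _) (hg d),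
          fun d hd => ?_, fun d b hb => ?_⟩
        · simp only [hg' d hd, altNat_le_supp r hq d hd, hf' d hd, one_mul]
        · rw [Perm.mul_apply, h' d b hb, h _ _ (apply_lt_of_mem_supp (hA (hg d)) hb)]
          rfl
      inv_mem' := by
        rintro e ⟨p, hp, f, hf, hf', h⟩
        refine ⟨p⁻¹, inv_mem hp, fun d => (f (p⁻¹ d))⁻¹, fun d => inv_mem (hf _),
          fun d hd => ?_, fun d b hb => ?_⟩
        · simp only [altNat_le_supp r (inv_mem hp) d hd, hf' d hd, inv_one]
        · rw [Perm.inv_eq_iff_eq,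
            h _ _ (apply_lt_of_mem_supp (hA (inv_mem (hf (p⁻¹ d)))) hb)]
          simp }
  have hle : wreath M r A ≤ K := by
    refine wreath_le (fun p hp => ?_) (fun d hd a ha => ?_)
    · exact ⟨p, hp, 1, fun _ => one_mem _, fun _ _ => rfl, fun d b hb => blk_block p d hb⟩
    · refine ⟨1, one_mem _, Function.update 1 d a, fun x => ?_, fun x hx => ?_, fun x b hb => ?_⟩
      · by_cases h : x = d
        · subst h
          simpa using ha
        · simp [h, one_mem]
      · simp [show x ≠ d by omega]
      · by_cases h : x = d
        · subst h
          simp [cp_block_self (hA ha) _ hb]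
        · simp [h, cp_block_of_ne (hA ha) h hb]
  exact hle he

/-- A subgroup containing the individual copies contains their product over the blocks. -/
theorem exists_mem_blockwise {M : ℕ} {K : Subgroup (Perm ℕ)} {f : ℕ → Perm ℕ}
    (hf : ∀ d, f d ∈ supp M) (k : ℕ) (hK : ∀ d < k, cp M d (f d) ∈ K) :
    ∃ g ∈ K, ∀ d b, b < M → g (M * d + b) = if d < k then M * d + f d b else M * d + b := by
  induction k with
  | zero => exact ⟨1, one_mem _, fun d b _ => by simp⟩
  | succ k ih =>
    obtain ⟨g, hg, h⟩ := ih fun d hd => hK d (by omega)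
    refine ⟨g * cp M k (f k), mul_mem hg (hK k (by omega)), fun d b hb => ?_⟩
    rw [Perm.mul_apply]
    by_cases hd : d = k
    · subst hd
      rw [cp_block_self (hf _) _ hb, h _ _ (apply_lt_of_mem_supp (hf _) hb)]
      simp
    · rw [cp_block_of_ne (hf k) hd hb, h d b hb]
      have : d < k + 1 ↔ d < k := by omega
      simp only [this]

/-- Permutations in `wreath` decompose as a block permutation times blockwise permutations. -/
theorem mem_of_normalForm {M r : ℕ} (hM : 0 < M) {A K : Subgroup (Perm ℕ)} (hA : A ≤ supp M)
    {e p : Perm ℕ} {f : ℕ → Perm ℕ} (hf : ∀ d, f d ∈ A) (hf' : ∀ d, r ≤ d → f d = 1)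
    (h : ∀ d b, b < M → e (M * d + b) = M * p d + f d b) (hp : blk M p ∈ K)
    (hK : ∀ d < r, cp M d (f d) ∈ K) : e ∈ K := by
  obtain ⟨g, hg, hg'⟩ := exists_mem_blockwise (fun d => hA (hf d)) r hK
  have : e = blk M p * g := by
    refine perm_ext_blocks hM fun d b hb => ?_
    rw [h d b hb, Perm.mul_apply, hg' d b hb]
    split_ifs with hd
    · rw [blk_block _ _ (apply_lt_of_mem_supp (hA (hf d)) hb)]
    · rw [blk_block _ _ hb, hf' d (by omega), Perm.one_apply]
  rw [this]
  exact mul_mem hp hg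

/-- Permutations of `Fin m` as permutations of `{1, …, m} ⊆ ℕ`. -/
noncomputable def sh (m : ℕ) : Perm (Fin m) →* Perm ℕ :=
  Perm.viaEmbeddingHom ⟨fun i : Fin m => (i : ℕ) + 1, fun i j h => Fin.ext (by simpa using h)⟩

theorem sh_apply_succ {m : ℕ} (e : Perm (Fin m)) (i : Fin m) : sh m e (i + 1) = e i + 1 :=
  Perm.viaEmbedding_apply e _ i

theorem sh_apply_zero {m : ℕ} (e : Perm (Fin m)) : sh m e 0 = 0 :=
  Perm.viaEmbedding_apply_of_notMem e _ 0 (by rintro ⟨i, hi⟩; simp at hi)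

theorem sh_apply_of_lt {m z : ℕ} (e : Perm (Fin m)) (hz : m < z) : sh m e z = z :=
  Perm.viaEmbedding_apply_of_notMem e _ z (by
    rintro ⟨i, rfl⟩
    exact absurd i.2 (not_lt.2 (Nat.lt_succ_iff.1 hz)))

theorem perm_ext_sh {m : ℕ} {p q : Perm ℕ} (h0 : p 0 = q 0)
    (h1 : ∀ i : Fin m, p (i + 1) = q (i + 1)) (h2 : ∀ z, m < z → p z = q z) : p = q := by
  ext z
  rcases z with _ | z
  · exact h0
  · by_cases hz : z < m
    · exact h1 ⟨z, hz⟩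
    · exact h2 _ (by omega)

theorem sh_eq_viaEmbeddingHom {m : ℕ} (e : Perm (Fin m)) :
    sh m e = Perm.viaEmbeddingHom Fin.valEmbedding (Perm.decomposeFin.symm (0, e)) := by
  refine perm_ext_sh (m := m) ?_ (fun i => ?_) fun z hz => ?_
  · rw [sh_apply_zero]
    rw [Perm.viaEmbeddingHom_apply]
    have := Perm.viaEmbedding_apply (Perm.decomposeFin.symm (0, e)) Fin.valEmbedding 0
    simpa using this.symm
  · rw [sh_apply_succ]
    rw [Perm.viaEmbeddingHom_apply]
    have := Perm.viaEmbedding_apply (Perm.decomposeFin.symm (0, e)) Fin.valEmbedding i.succ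
    simpa using this.symm
  · rw [sh_apply_of_lt e hz, Perm.viaEmbeddingHom_apply, Perm.viaEmbedding_apply_of_notMem]
    rintro ⟨i, rfl⟩
    exact absurd i.2 (by simp only [Fin.valEmbedding_apply] at hz; omega)

theorem sh_mem_altNat {m : ℕ} {e : Perm (Fin m)} (he : Perm.sign e = 1) :
    sh m e ∈ altNat (m + 1) := by
  rw [sh_eq_viaEmbeddingHom]
  exact mem_altNat_fin _ (by simp [he])

theorem exists_eq_sh {m : ℕ} {p : Perm ℕ} (hp : p ∈ altNat (m + 1)) (h0 : p 0 = 0) :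
    ∃ e : Perm (Fin m), Perm.sign e = 1 ∧ p = sh m e := by
  obtain ⟨e', he', rfl⟩ := hp
  obtain ⟨⟨c, e⟩, rfl⟩ := Perm.decomposeFin.symm.surjective e'
  have h1 := Perm.viaEmbedding_apply (Perm.decomposeFin.symm (c, e)) Fin.valEmbedding 0
  have h2 : c = 0 := by
    rw [Perm.viaEmbeddingHom_apply] at h0
    simp only [Fin.valEmbedding_apply, Fin.val_zero, Perm.decomposeFin_symm_apply_zero] at h1
    exact Fin.ext (by rw [← h1, h0, Fin.val_zero])
  subst h2
  refine ⟨e, ?_, (sh_eq_viaEmbeddingHom e).symm⟩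
  have : Perm.sign (Perm.decomposeFin.symm (0, e)) = 1 := he'
  simpa using this

theorem sh_swap {m : ℕ} (i j : Fin m) : sh m (swap i j) = swap ((i : ℕ) + 1) (j + 1) := by
  refine perm_ext_sh (m := m) ?_ (fun k => ?_) fun z hz => ?_
  · rw [sh_apply_zero, swap_apply_of_ne_of_ne] <;> omega
  · rw [sh_apply_succ]
    by_cases h : k = i
    · subst h
      simp
    · by_cases h' : k = j
      · subst h'
        simp
      · rw [swap_apply_of_ne_of_ne h h', swap_apply_of_ne_of_ne]
        · simpa [Fin.ext_iff] using h
        · simpa [Fin.ext_iff] using h'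
  · rw [sh_apply_of_lt _ hz, swap_apply_of_ne_of_ne] <;> omega

theorem exists_sh_eq_swap_mul_swap {m i j k : ℕ} (hi : 1 ≤ i) (hj : 1 ≤ j) (hk : 1 ≤ k)
    (him : i ≤ m) (hjm : j ≤ m) (hkm : k ≤ m) (hij : i ≠ j) (hjk : j ≠ k) :
    ∃ e : Perm (Fin m), Perm.sign e = 1 ∧ sh m e = swap i j * swap j k := by
  refine ⟨swap ⟨i - 1, by omega⟩ ⟨j - 1, by omega⟩ * swap ⟨j - 1, by omega⟩ ⟨k - 1, by omega⟩,
    ?_, ?_⟩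
  · rw [map_mul, Perm.sign_swap, Perm.sign_swap]
    · rfl
    · simp only [ne_eq, Fin.mk.injEq]
      omega
    · simp only [ne_eq, Fin.mk.injEq]
      omega
  · simp only [map_mul, sh_swap]
    congr <;> omega

/-- The cyclic rotation of `{1, …, m}`. -/
noncomputable def rot (m : ℕ) : Perm ℕ := sh m (finRotate m)

theorem finRotate_pow_apply {m : ℕ} (j : ℕ) (i : Fin m) :
    ((finRotate m ^ j) i : ℕ) = (i + j) % m := by
  have : NeZero m := ⟨by have := i.2; omega⟩
  induction j with
  | zero => simp [Nat.mod_eq_of_lt i.2]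
  | succ j ih =>
    rw [pow_succ', Perm.mul_apply, finRotate_apply, Fin.val_add, ih]
    simp [← add_assoc]

theorem rot_pow_self (m : ℕ) : rot m ^ m = 1 := by
  rw [rot, ← map_pow]
  have : finRotate m ^ m = 1 := by
    ext i
    rw [finRotate_pow_apply]
    simp [Nat.mod_eq_of_lt i.2]
  rw [this, map_one]

theorem rot_pow_apply {m i j : ℕ} (hi : 1 ≤ i) (hij : i + j ≤ m) : (rot m ^ j) i = i + j := by
  rw [rot, ← map_pow]
  have h := sh_apply_succ (finRotate m ^ j) ⟨i - 1, by omega⟩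
  rw [finRotate_pow_apply] at h
  simp only at h
  rw [Nat.mod_eq_of_lt (by omega), Nat.sub_add_cancel hi] at h
  rw [h]
  omega

theorem rot_mem_altNat {m : ℕ} (hm : Odd m) : rot m ∈ altNat (m + 1) := by
  refine sh_mem_altNat ?_
  rw [sign_finRotate]
  exact (Nat.Odd.sub_odd hm odd_one).neg_one_pow

theorem commutator_threeCycles :
    (⁅(swap 1 4 * swap 4 3 : Perm ℕ), (swap 3 2 * swap 2 5 : Perm ℕ)⁆ : Perm ℕ) =
      swap 1 2 * swap 2 3 := by
  have h : ⁅(swap 0 3 * swap 3 2 : Perm (Fin 5)), (swap 2 1 * swap 1 4 : Perm (Fin 5))⁆ =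
      swap 0 1 * swap 1 2 := by decide
  have h2 := congrArg (sh 5) h
  simp only [map_commutatorElement, map_mul, sh_swap] at h2
  exact h2

theorem conj_threeCycle (p : Perm ℕ) (i j k : ℕ) :
    p * (swap i j * swap j k) * p⁻¹ = swap (p i) (p j) * swap (p j) (p k) := by
  rw [swap_apply_apply, swap_apply_apply]
  group

theorem commute_conj_rot_threeCycle {m j : ℕ} (hj : 5 ≤ j) (hjm : j + 5 ≤ m) :
    Commute (swap 1 4 * swap 4 3) (rot m ^ j * (swap 3 2 * swap 2 5) * (rot m ^ j)⁻¹) := by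
  rw [conj_threeCycle, rot_pow_apply (by omega) (by omega), rot_pow_apply (by omega) (by omega),
    rot_pow_apply (by omega) (by omega)]
  refine Commute.mul_left (Commute.mul_right ?_ ?_) (Commute.mul_right ?_ ?_) <;>
  · refine (Perm.disjoint_swap_swap ?_).commute
    simp
    omega

/-- A subgroup containing the `3`-cycles on consecutive points of `{1, …, m}` contains all even
permutations of `{1, …, m}`. -/
theorem sh_mem_of_consecutive {m : ℕ} (hm : 2 ≤ m) {K : Subgroup (Perm ℕ)}
    (hK : ∀ i, 1 ≤ i → i + 2 ≤ m → swap i (i + 1) * swap (i + 1) (i + 2) ∈ K)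
    {e : Perm (Fin m)} (he : Perm.sign e = 1) : sh m e ∈ K := by
  obtain ⟨n, rfl⟩ : ∃ n, m = n + 1 := ⟨m - 1, by omega⟩
  have h0 : ∀ j, j + 1 < n + 1 → swap 1 2 * swap (j + 1) (j + 2) ∈ K := by
    intro j
    induction j with
    | zero =>
      intro _
      simp
    | succ j ih =>
      intro hj
      have h1 := mul_mem (ih (by omega)) (hK (j + 1) (by omega) (by omega))
      rwa [mul_assoc, ← mul_assoc (swap (j + 1) (j + 2)), swap_mul_self, one_mul] at h1
  have h1 : ∀ i j, i + 1 < n + 1 → j + 1 < n + 1 →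
      swap (i + 1) (i + 2) * swap (j + 1) (j + 2) ∈ K := by
    intro i j hi hj
    have := mul_mem (inv_mem (h0 i hi)) (h0 j hj)
    rwa [mul_inv_rev, swap_inv, swap_inv, mul_assoc, ← mul_assoc (swap 1 2), swap_mul_self,
      one_mul] at this
  have key : (Perm.sign e = 1 ∧ sh (n + 1) e ∈ K) ∨
      (Perm.sign e = -1 ∧ swap 1 2 * sh (n + 1) e ∈ K) := by
    have hmem : e ∈ Submonoid.closure
        (Set.range fun i : Fin n => swap i.castSucc i.succ) := by
      rw [Perm.mclosure_swap_castSucc_succ]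
      trivial
    clear he
    induction hmem using Submonoid.closure_induction_left with
    | one => exact Or.inl ⟨map_one _, by rw [map_one]; exact one_mem _⟩
    | mul_left x hx y hy ih =>
      obtain ⟨i, rfl⟩ := hx
      have hs : Perm.sign (swap i.castSucc i.succ) = -1 :=
        Perm.sign_swap (by simp [Fin.ext_iff])
      have hsh : sh (n + 1) (swap i.castSucc i.succ) = swap (i + 1 : ℕ) (i + 2) := by
        rw [sh_swap]
        simp
      rcases ih with ⟨h, h'⟩ | ⟨h, h'⟩
      · refine Or.inr ⟨by simp [hs, h], ?_⟩
        rw [map_mul, hsh, ← mul_assoc]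
        exact mul_mem (h0 i (by omega)) h'
      · refine Or.inl ⟨by simp [hs, h], ?_⟩
        have h2 := mul_mem (h1 i 0 (by omega) (by omega)) h'
        rw [zero_add, zero_add, mul_assoc, ← mul_assoc (swap 1 2), swap_mul_self, one_mul] at h2
        rwa [map_mul, hsh]
  rcases key with ⟨_, h⟩ | ⟨h, _⟩
  · exact h
  · rw [he] at h
    exact absurd h (by decide)

theorem commutatorElement_mul_mul {G : Type*} [Group G] {p q r s : G} (hqr : Commute q r)
    (hqs : Commute q s) (hsp : Commute s p) :
    ⁅p * q, r * s⁆ = ⁅p, r⁆ := by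
  have h1 : q * (r * s) * q⁻¹ = r * s := by
    rw [(hqr.mul_right hqs).eq, mul_inv_cancel_right]
  have h2 : s * p⁻¹ * s⁻¹ = p⁻¹ := by
    rw [hsp.inv_right.eq, mul_inv_cancel_right]
  calc ⁅p * q, r * s⁆ = p * (q * (r * s) * q⁻¹) * p⁻¹ * (r * s)⁻¹ := by
        rw [commutatorElement_def]; group
    _ = p * r * (s * p⁻¹ * s⁻¹) * r⁻¹ := by rw [h1]; group
    _ = ⁅p, r⁆ := by rw [h2, commutatorElement_def]

theorem threeCycle_apply {i j k : ℕ} (hij : i ≠ j) (hjk : j ≠ k) (hik : i ≠ k) :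
    (swap i j * swap j k) i = j ∧ (swap i j * swap j k) j = k ∧ (swap i j * swap j k) k = i ∧
      ∀ z, z ≠ i → z ≠ j → z ≠ k → (swap i j * swap j k) z = z := by
  refine ⟨?_, ?_, ?_, fun z hi hj hk => ?_⟩
  · rw [Perm.mul_apply, swap_apply_of_ne_of_ne hij hik, swap_apply_left]
  · rw [Perm.mul_apply, swap_apply_left, swap_apply_of_ne_of_ne hik.symm hjk.symm]
  · rw [Perm.mul_apply, swap_apply_right, swap_apply_right]
  · rw [Perm.mul_apply, swap_apply_of_ne_of_ne hj hk, swap_apply_of_ne_of_ne hi hj]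

theorem mul_blk_threeCycle {M i j k : ℕ} (hM : 0 < M) {u : Perm ℕ} {f : ℕ → Perm ℕ}
    (hf : ∀ d, f d ∈ supp M) (hu : ∀ d b, b < M → u (M * d + b) = M * d + f d b)
    (hij : i ≠ j) (hjk : j ≠ k) (hik : i ≠ k) (hj : f j = 1) (hk : f k = 1) :
    u * blk M (swap i j * swap j k) * u⁻¹ * (blk M (swap i j * swap j k))⁻¹ =
      cp M i (f i) * cp M j (f i)⁻¹ := by
  obtain ⟨h1, h2, h3, h4⟩ := threeCycle_apply hij hjk hik
  rw [mul_inv_eq_iff_eq_mul, mul_inv_eq_iff_eq_mul]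
  refine perm_ext_blocks hM fun d b hb => ?_
  have hfb : ∀ d, f d b < M := fun d => apply_lt_of_mem_supp (hf d) hb
  have hi' : (f i)⁻¹ ∈ supp M := inv_mem (hf i)
  simp only [Perm.mul_apply _ _ (M * d + b), Perm.mul_apply (cp M i (f i) * cp M j (f i)⁻¹),
    Perm.mul_apply (cp M i (f i))]
  rw [blk_block _ _ hb, hu _ _ hb, hu _ _ hb, blk_block _ _ (hfb d)]
  by_cases hdi : d = i
  · subst hdi
    rw [h1, cp_block_self hi' _ (hfb d), hj, Perm.one_apply, show (f d)⁻¹ (f d b) = b from (f d).symm_apply_apply b,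
      cp_block_of_ne (hf d) hij.symm hb]
  by_cases hdj : d = j
  · subst hdj
    rw [h2, hj, hk, Perm.one_apply, cp_block_of_ne hi' hjk.symm hb,
      cp_block_of_ne (hf i) hik.symm hb]
  by_cases hdk : d = k
  · subst hdk
    rw [h3, hk, Perm.one_apply, cp_block_of_ne hi' hij hb, cp_block_self (hf i) _ hb]
  · rw [h4 d hdi hdj hdk, cp_block_of_ne hi' hdj (hfb d), cp_block_of_ne (hf i) hdi (hfb d)]

/-- If `K` contains the `3`-cycles of blocks and is normalized by an element `u` acting on the
blocks by a list of all the elements of a perfect group `A`, then it contains every copy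
of `A`. -/
theorem cp_mem_of_normalized {M m : ℕ} (hM : 0 < M) (hm : 4 ≤ m) {A K : Subgroup (Perm ℕ)}
    (hA : A ≤ supp M) (hA' : A ≤ ⁅A, A⁆)
    (hK : ∀ i j k, 1 ≤ i → 1 ≤ j → 1 ≤ k → i ≤ m → j ≤ m → k ≤ m → i ≠ j → j ≠ k → i ≠ k →
      blk M (swap i j * swap j k) ∈ K)
    {u : Perm ℕ} (hKu : ∀ w ∈ K, u * w * u⁻¹ ∈ K) {f : ℕ → Perm ℕ} (hf : ∀ d, f d ∈ A)
    (hu : ∀ d b, b < M → u (M * d + b) = M * d + f d b)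
    (hfA : ∀ a ∈ A, ∃ i, 1 ≤ i ∧ i + 3 ≤ m ∧ f i = a)
    (hf1 : ∀ i, m < i + 3 → f i = 1) {a : Perm ℕ} (ha : a ∈ A) {d : ℕ} (hd : 1 ≤ d)
    (hdm : d ≤ m) : cp M d a ∈ K := by
  have hfs : ∀ d, f d ∈ supp M := fun d => hA (hf d)
  have conj_mem : ∀ {g w}, g ∈ K → w ∈ K → g * w * g⁻¹ ∈ K := fun hg hw =>
    mul_mem (mul_mem hg hw) (inv_mem hg)
  have conj_mul : ∀ p x y (a b : Perm ℕ), a ∈ A → b ∈ A →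
      blk M p * (cp M x a * cp M y b) * (blk M p)⁻¹ = cp M (p x) a * cp M (p y) b := by
    intro p x y a b ha hb
    rw [← conj_blk_cp hM (hA ha), ← conj_blk_cp hM (hA hb)]
    group
  have hP : ∀ a ∈ A, cp M (m - 2) a * cp M m a⁻¹ ∈ K := by
    intro a ha
    obtain ⟨i, hi, him, rfl⟩ := hfA a ha
    have h3 := hK i m (m - 1) (by omega) (by omega) (by omega) (by omega) (by omega) (by omega)
      (by omega) (by omega) (by omega)
    have h4 := mul_mem (hKu _ h3) (inv_mem h3)
    rw [mul_blk_threeCycle hM hfs hu (by omega) (by omega) (by omega) (hf1 m (by omega))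
      (hf1 (m - 1) (by omega))] at h4
    have h5 := conj_mem (hK i (m - 2) (m - 1) (by omega) (by omega) (by omega) (by omega)
      (by omega) (by omega) (by omega) (by omega) (by omega)) h4
    obtain ⟨e1, _, _, e4⟩ := threeCycle_apply (i := i) (j := m - 2) (k := m - 1) (by omega)
      (by omega) (by omega)
    rwa [conj_mul _ _ _ _ _ ha (inv_mem ha), e1, e4 m (by omega) (by omega) (by omega)] at h5
  have hQ : ∀ a ∈ A, cp M (m - 2) a * cp M (m - 1) a⁻¹ ∈ K := by
    intro a ha
    have h5 := conj_mem (hK m (m - 1) 1 (by omega) (by omega) (by omega) (by omega)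
      (by omega) (by omega) (by omega) (by omega) (by omega)) (hP a ha)
    obtain ⟨e1, _, _, e4⟩ := threeCycle_apply (i := m) (j := m - 1) (k := 1) (by omega)
      (by omega) (by omega)
    rwa [conj_mul _ _ _ _ _ ha (inv_mem ha), e1,
      e4 (m - 2) (by omega) (by omega) (by omega)] at h5
  have hcomm : ⁅A, A⁆ ≤ K.comap (MulAut.conj (blk M (swap 0 (m - 2)))).toMonoidHom := by
    rw [Subgroup.commutator_le]
    intro a ha b hb
    have h6 : ⁅cp M (m - 2) a * cp M m a⁻¹, cp M (m - 2) b * cp M (m - 1) b⁻¹⁆ ∈ K := by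
      rw [commutatorElement_def]
      exact mul_mem (mul_mem (mul_mem (hP a ha) (hQ b hb)) (inv_mem (hP a ha)))
        (inv_mem (hQ b hb))
    rw [commutatorElement_mul_mul (commute_cp hM (hA (inv_mem ha)) (hA hb) (by omega))
      (commute_cp hM (hA (inv_mem ha)) (hA (inv_mem hb)) (by omega))
      (commute_cp hM (hA (inv_mem hb)) (hA ha) (by omega))] at h6
    rw [Subgroup.mem_comap, map_commutatorElement]
    exact h6
  have hlast : cp M (m - 2) a ∈ K := hcomm (hA' ha)
  by_cases hdt : d = m - 2
  · rwa [hdt]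
  obtain ⟨k, hk1, hkm, hkd, hkt⟩ : ∃ k, 1 ≤ k ∧ k ≤ m ∧ d ≠ k ∧ m - 2 ≠ k := by
    by_cases h : d = m
    · exact ⟨m - 1, by omega, by omega, by omega, by omega⟩
    · exact ⟨m, by omega, by omega, by omega, by omega⟩
  have h7 := conj_mem (hK (m - 2) d k (by omega) hd hk1 (by omega) hdm hkm (by omega) hkd hkt)
    hlast
  rwa [conj_blk_cp hM (hA ha), (threeCycle_apply (by omega) hkd hkt).1] at h7

theorem finite_supp (M : ℕ) : Finite (supp M) := by
  let Φ : supp M → (Fin M → Fin M) := fun p i => ⟨p.1 i, apply_lt_of_mem_supp p.2 i.2⟩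
  refine Finite.of_injective Φ fun p q h => ?_
  ext z
  by_cases hz : z < M
  · have := congrFun h ⟨z, hz⟩
    simpa [Φ, Fin.ext_iff] using this
  · rw [p.2 z (not_lt.1 hz), q.2 z (not_lt.1 hz)]

/-- The arity of the next wreath product, given a triple `(M, L, A)` consisting of the size of the
initial block, the shift length and the group acting on the block. -/
noncomputable def towerArity (s : ℕ × ℕ × Subgroup (Perm ℕ)) : ℕ :=
  2 * (s.2.1 + Nat.card s.2.2 + 10) + 1

/-- The iterated wreath products, together with their degrees and shift lengths. -/
noncomputable def tower : ℕ → ℕ × ℕ × Subgroup (Perm ℕ)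
  | 0 => (1, 5, ⊥)
  | n + 1 => ((tower n).1 * (towerArity (tower n) + 1), (tower n).2.1 * towerArity (tower n),
      wreath (tower n).1 (towerArity (tower n) + 1) (tower n).2.2)

/-- The degree of the `n`-th group. -/
noncomputable def deg (n : ℕ) : ℕ := (tower n).1

/-- The shift length at level `n`. -/
noncomputable def len (n : ℕ) : ℕ := (tower n).2.1

/-- The `n`-th iterated wreath product. -/
noncomputable def grp (n : ℕ) : Subgroup (Perm ℕ) := (tower n).2.2

/-- The number of blocks other than the initial one at level `n`. -/
noncomputable def arity (n : ℕ) : ℕ := towerArity (tower n)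

theorem deg_zero : deg 0 = 1 := by simp only [deg, tower]

theorem deg_succ (n : ℕ) : deg (n + 1) = deg n * (arity n + 1) := by
  simp only [deg, tower, arity]

theorem len_succ (n : ℕ) : len (n + 1) = len n * arity n := by
  simp only [len, tower, arity]

theorem grp_zero : grp 0 = ⊥ := by simp only [grp, tower]

theorem grp_succ (n : ℕ) : grp (n + 1) = wreath (deg n) (arity n + 1) (grp n) := by
  simp only [grp, deg, tower, arity]

theorem arity_eq (n : ℕ) : arity n = 2 * (len n + Nat.card (grp n) + 10) + 1 := rfl

theorem odd_arity (n : ℕ) : Odd (arity n) := ⟨_, arity_eq n⟩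

theorem deg_pos (n : ℕ) : 0 < deg n := by
  induction n with
  | zero => simp [deg_zero]
  | succ n ih =>
    rw [deg_succ]
    positivity

theorem five_le_len (n : ℕ) : 5 ≤ len n := by
  induction n with
  | zero => simp [len, tower]
  | succ n ih =>
    rw [len_succ]
    have := arity_eq n
    nlinarith

theorem len_mono : Monotone len := by
  refine monotone_nat_of_le_succ fun n => ?_
  rw [len_succ]
  have := arity_eq n
  nlinarith

theorem deg_strictMono : StrictMono deg := by
  refine strictMono_nat_of_lt_succ fun n => ?_
  rw [deg_succ]
  have := arity_eq n
  have := deg_pos n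
  nlinarith

theorem len_add_five_le {n N : ℕ} (h : N < n) : len N + 5 ≤ len n := by
  have h1 := len_mono (Nat.succ_le_of_lt h)
  have h2 := len_succ N
  have h3 := arity_eq N
  have h4 := five_le_len N
  simp only [Nat.succ_eq_add_one] at h1
  nlinarith

theorem arity_dvd_len {n N : ℕ} (h : n < N) : arity n ∣ len N := by
  induction N, h using Nat.le_induction with
  | base =>
    rw [Nat.succ_eq_add_one, len_succ]
    exact dvd_mul_left _ _
  | succ N _ ih =>
    rw [len_succ]
    exact ih.mul_right _

theorem grp_le_supp (n : ℕ) : grp n ≤ supp (deg n) := by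
  induction n with
  | zero =>
    rw [grp_zero]
    exact bot_le
  | succ n ih =>
    rw [grp_succ, deg_succ]
    exact wreath_le_supp ih

instance finite_grp (n : ℕ) : Finite (grp n) :=
  have := finite_supp (deg n)
  Finite.of_injective _ (Subgroup.inclusion_injective (grp_le_supp n))

theorem grp_mono : Monotone grp := by
  refine monotone_nat_of_le_succ fun n => ?_
  rw [grp_succ]
  exact le_wreath _ (Nat.succ_pos _)

theorem grp_le_commutator (n : ℕ) : grp n ≤ ⁅grp n, grp n⁆ := by
  induction n with
  | zero =>
    rw [grp_zero]
    exact bot_le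
  | succ n ih =>
    rw [grp_succ]
    have := arity_eq n
    exact wreath_le_commutator (by omega) ih

theorem exists_lister (n : ℕ) : ∃ (u : Perm ℕ) (f : ℕ → Perm ℕ), u ∈ grp (n + 1) ∧
    (∀ d, f d ∈ grp n) ∧ f 0 = 1 ∧
    (∀ d b, b < deg n → u (deg n * d + b) = deg n * d + f d b) ∧
    (∀ a ∈ grp n, ∃ i, 1 ≤ i ∧ i + 3 ≤ arity n ∧ f i = a) ∧ ∀ i, arity n < i + 3 → f i = 1 := by
  let E := Finite.equivFin (grp n)
  let f : ℕ → Perm ℕ := fun d =>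
    if h : 1 ≤ d ∧ d ≤ Nat.card (grp n) then (E.symm ⟨d - 1, by omega⟩).1 else 1
  have har := arity_eq n
  have hf : ∀ d, f d ∈ grp n := by
    intro d
    simp only [f]
    split_ifs
    · exact (E.symm _).2
    · exact one_mem _
  have hf1 : ∀ i, arity n < i + 3 → f i = 1 := by
    intro i hi
    simp only [f]
    rw [dif_neg (by omega)]
  obtain ⟨u, hu, hu'⟩ := exists_mem_blockwise (M := deg n) (K := grp (n + 1))
    (fun d => grp_le_supp n (hf d)) (arity n + 1) fun d hd => by
      rw [grp_succ]
      exact cp_mem_wreath (hf d) hd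
  refine ⟨u, f, hu, hf, by simp [f], fun d b hb => ?_, fun a ha => ?_, hf1⟩
  · rw [hu' d b hb]
    split_ifs with h
    · rfl
    · rw [hf1 d (by omega), Perm.one_apply]
  · have h1 := (E ⟨a, ha⟩).2
    refine ⟨E ⟨a, ha⟩ + 1, by omega, by omega, ?_⟩
    simp only [f]
    rw [dif_pos ⟨by omega, by omega⟩]
    simp

/-- The families of permutations whose `n`-th member belongs to the `n + 1`-st group and fixes the
`n`-th block pointwise. -/
def ann : Subgroup (ℕ → Perm ℕ) where
  carrier := {g | ∀ n, g n ∈ grp (n + 1) ∧ ∀ z, z < deg n → g n z = z}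
  one_mem' := fun _ => ⟨one_mem _, fun _ _ => rfl⟩
  mul_mem' := by
    intro g h hg hh n
    refine ⟨mul_mem (hg n).1 (hh n).1, fun z hz => ?_⟩
    rw [Pi.mul_apply, Perm.mul_apply, (hh n).2 z hz, (hg n).2 z hz]
  inv_mem' := by
    intro g hg n
    refine ⟨inv_mem (hg n).1, fun z hz => ?_⟩
    rw [Pi.inv_apply, Perm.inv_eq_iff_eq, (hg n).2 z hz]

theorem le_apply_of_mem_ann {g : ℕ → Perm ℕ} (hg : g ∈ ann) {n z : ℕ} (hz : deg n ≤ z) :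
    deg n ≤ g n z := by
  by_contra h
  push Not at h
  have := (g n).injective ((hg n).2 _ h)
  omega

theorem exists_lt_deg (z : ℕ) : ∃ n, z < deg (n + 1) :=
  ⟨z, by have := deg_strictMono.le_apply (x := z + 1); omega⟩

/-- The index of the annulus containing `z`. -/
noncomputable def lev (z : ℕ) : ℕ := Nat.find (exists_lt_deg z)

theorem lt_deg_lev (z : ℕ) : z < deg (lev z + 1) := Nat.find_spec (exists_lt_deg z)

theorem lev_le {z n : ℕ} (h : z < deg (n + 1)) : lev z ≤ n := Nat.find_le h

theorem deg_lev_le {z : ℕ} (hz : z ≠ 0) : deg (lev z) ≤ z := by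
  rcases h : lev z with _ | n
  · rw [deg_zero]
    omega
  · by_contra h'
    have := lev_le (not_le.1 h')
    omega

theorem lev_eq {z n : ℕ} (h : deg n ≤ z) (h' : z < deg (n + 1)) : lev z = n := by
  refine le_antisymm (lev_le h') ?_
  by_contra hn
  have := deg_strictMono.monotone (show lev z + 1 ≤ n by omega)
  have := lt_deg_lev z
  omega

theorem lev_apply {g : ℕ → Perm ℕ} (hg : g ∈ ann) (z : ℕ) : lev (g (lev z) z) = lev z := by
  rcases eq_or_ne z 0 with rfl | hz
  · rw [(hg _).2 0 (deg_pos _)]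
  · exact lev_eq (le_apply_of_mem_ann hg (deg_lev_le hz))
      (apply_lt_of_mem_supp (grp_le_supp _ (hg _).1) (lt_deg_lev z))

/-- The permutation acting on each annulus by the corresponding member of a family. -/
noncomputable def glue : ann →* Perm ℕ :=
  MonoidHom.toHomPerm
    { toFun := fun g z => g.1 (lev z) z
      map_one' := rfl
      map_mul' := by
        intro g h
        funext z
        change g.1 (lev z) (h.1 (lev z) z) = g.1 (lev (h.1 (lev z) z)) (h.1 (lev z) z)
        rw [lev_apply h.2] }

theorem glue_apply (g : ann) (z : ℕ) : glue g z = g.1 (lev z) z := rfl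

theorem glue_eq_of_coe_eq_mulSingle {g : ann} {n : ℕ} {w : Perm ℕ} (h : g.1 = Pi.mulSingle n w) :
    glue g = w := by
  have hw : w = g.1 n := by rw [h, Pi.mulSingle_eq_same]
  ext z
  rw [glue_apply]
  by_cases hn : lev z = n
  · rw [hn, hw]
  · have h1 : g.1 (lev z) = 1 := by rw [h, Pi.mulSingle_eq_of_ne hn]
    rw [h1, hw, Perm.one_apply]
    symm
    by_cases hz : z < deg n
    · exact (g.2 n).2 z hz
    · refine grp_le_supp _ (g.2 n).1 z ?_
      by_contra hz'
      exact hn (lev_eq (not_lt.1 hz) (not_le.1 hz'))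

theorem exists_eqOn_glue (g : ann) (n : ℕ) : ∃ a ∈ grp n, ∀ z, z < deg n → glue g z = a z := by
  induction n with
  | zero =>
    refine ⟨1, one_mem _, fun z hz => ?_⟩
    rw [deg_zero, Nat.lt_one_iff] at hz
    subst hz
    rw [glue_apply, (g.2 _).2 0 (deg_pos _), Perm.one_apply]
  | succ n ih =>
    obtain ⟨a, ha, h⟩ := ih
    refine ⟨a * g.1 n, mul_mem (grp_mono n.le_succ ha) (g.2 n).1, fun z hz => ?_⟩
    rw [Perm.mul_apply]
    by_cases hz' : z < deg n
    · rw [(g.2 n).2 z hz', h z hz']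
    · rw [grp_le_supp n ha _ (le_apply_of_mem_ann g.2 (not_lt.1 hz')), glue_apply,
        lev_eq (not_lt.1 hz') hz]

theorem blk_mem_grp {n : ℕ} {p : Perm ℕ} (hp : p ∈ altNat (arity n + 1)) :
    blk (deg n) p ∈ grp (n + 1) := by
  rw [grp_succ]
  exact blk_mem_wreath _ hp

theorem blk_family_mem_ann {p : ℕ → Perm ℕ} (hp : ∀ n, p n ∈ altNat (arity n + 1))
    (h0 : ∀ n, p n 0 = 0) : (fun n => blk (deg n) (p n)) ∈ ann := by
  intro n
  refine ⟨blk_mem_grp (hp n), fun z hz => ?_⟩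
  have := blk_block (p n) 0 hz
  rwa [h0, mul_zero, zero_add] at this

theorem rot_zero (m : ℕ) : rot m 0 = 0 := sh_apply_zero _

theorem rot_pow_zero (m j : ℕ) : (rot m ^ j) 0 = 0 := by
  rw [rot, ← map_pow, sh_apply_zero]

theorem threeCycle_mem_altNat {m i j k : ℕ} (hi : 1 ≤ i) (hj : 1 ≤ j) (hk : 1 ≤ k)
    (him : i ≤ m) (hjm : j ≤ m) (hkm : k ≤ m) (hij : i ≠ j) (hjk : j ≠ k) :
    swap i j * swap j k ∈ altNat (m + 1) := by
  obtain ⟨e, he, h⟩ := exists_sh_eq_swap_mul_swap hi hj hk him hjm hkm hij hjk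
  rw [← h]
  exact sh_mem_altNat he

/-- The rotation of the non-initial blocks, at every level. -/
noncomputable def genRot : ann :=
  ⟨fun n => blk (deg n) (rot (arity n)),
    blk_family_mem_ann (fun n => rot_mem_altNat (odd_arity n)) fun _ => rot_zero _⟩

/-- A fixed `3`-cycle of blocks, at every level. -/
noncomputable def genFst : ann :=
  ⟨fun n => blk (deg n) (swap 1 4 * swap 4 3),
    blk_family_mem_ann
      (fun n => by
        have := arity_eq n
        apply threeCycle_mem_altNat <;> omega)
      fun _ => (threeCycle_apply (by omega) (by omega) (by omega)).2.2.2 0 (by omega) (by omega)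
        (by omega)⟩

/-- A `3`-cycle of blocks shifted by the length of the level, at every level. -/
noncomputable def genSnd : ann :=
  ⟨fun n => blk (deg n) (rot (arity n) ^ len n * (swap 3 2 * swap 2 5) *
      (rot (arity n) ^ len n)⁻¹),
    blk_family_mem_ann
      (fun n => by
        have := arity_eq n
        have h := pow_mem (rot_mem_altNat (odd_arity n)) (len n)
        refine mul_mem (mul_mem h ?_) (inv_mem h)
        apply threeCycle_mem_altNat <;> omega)
      fun n => by
        have h := rot_pow_zero (arity n) (len n)
        rw [Perm.mul_apply, Perm.inv_eq_iff_eq.2 h.symm, Perm.mul_apply,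
          (threeCycle_apply (by omega) (by omega) (by omega)).2.2.2 0 (by omega) (by omega)
            (by omega), h]⟩

/-- An element listing the previous group on the non-initial blocks, at every level. -/
noncomputable def genList : ann :=
  ⟨fun n => (exists_lister n).choose, fun n => by
    obtain ⟨f, hu, _, h0, h, _⟩ := (exists_lister n).choose_spec
    refine ⟨hu, fun z hz => ?_⟩
    have := h 0 z hz
    rwa [h0, Perm.one_apply, mul_zero, zero_add] at this⟩

/-- The group generated by the four families. -/
noncomputable def famGrp : Subgroup ann := Subgroup.closure {genRot, genFst, genSnd, genList}

theorem genRot_mem : genRot ∈ famGrp := Subgroup.subset_closure (by simp)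

theorem genFst_mem : genFst ∈ famGrp := Subgroup.subset_closure (by simp)

theorem genSnd_mem : genSnd ∈ famGrp := Subgroup.subset_closure (by simp)

theorem genList_mem : genList ∈ famGrp := Subgroup.subset_closure (by simp)

/-- The permutations `w` such that the family with the single nontrivial member `w` at level `n`
lies in `famGrp`. -/
noncomputable def single (n : ℕ) : Subgroup (Perm ℕ) :=
  (famGrp.map ann.subtype).comap (MonoidHom.mulSingle (fun _ : ℕ => Perm ℕ) n)

theorem mem_single {n : ℕ} {w : Perm ℕ} :
    w ∈ single n ↔ ∃ g ∈ famGrp, g.1 = Pi.mulSingle n w := Iff.rfl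

theorem conj_mem_single {n : ℕ} {w : Perm ℕ} {g : ann} (hg : g ∈ famGrp) (hw : w ∈ single n) :
    g.1 n * w * (g.1 n)⁻¹ ∈ single n := by
  obtain ⟨h, hh, e⟩ := mem_single.1 hw
  refine mem_single.2 ⟨g * h * g⁻¹, mul_mem (mul_mem hg hh) (inv_mem hg), ?_⟩
  funext k
  simp only [Subgroup.coe_mul, Subgroup.coe_inv, Pi.mul_apply, Pi.inv_apply, e]
  by_cases hk : k = n
  · subst hk
    simp
  · simp [Pi.mulSingle_eq_of_ne hk]

theorem glue_mem_of_mem_single {n : ℕ} {w : Perm ℕ} (hw : w ∈ single n) :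
    w ∈ famGrp.map glue := by
  obtain ⟨g, hg, e⟩ := mem_single.1 hw
  exact ⟨g, hg, glue_eq_of_coe_eq_mulSingle e⟩

/-- The commutator of suitably shifted `3`-cycles is concentrated at a single level. -/
theorem blk_threeCycle_mem_single (N : ℕ) :
    blk (deg N) (swap 1 2 * swap 2 3) ∈ single N := by
  have hmem := mul_mem (mul_mem (inv_mem (pow_mem genRot_mem (len N))) genSnd_mem)
    (pow_mem genRot_mem (len N))
  have hmem' := mul_mem (mul_mem (mul_mem genFst_mem hmem) (inv_mem genFst_mem)) (inv_mem hmem)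
  refine mem_single.2 ⟨_, hmem', ?_⟩
  funext n
  have key : ⁅(swap 1 4 * swap 4 3 : Perm ℕ), (rot (arity n) ^ len N)⁻¹ *
      (rot (arity n) ^ len n * (swap 3 2 * swap 2 5) * (rot (arity n) ^ len n)⁻¹) *
      rot (arity n) ^ len N⁆ = if n = N then swap 1 2 * swap 2 3 else 1 := by
    have har := arity_eq n
    have h5 := five_le_len n
    rcases lt_trichotomy n N with h | rfl | h
    · obtain ⟨k, hk⟩ := arity_dvd_len h
      rw [if_neg h.ne, commutatorElement_eq_one_iff_commute]
      have h1 : rot (arity n) ^ len N = 1 := by rw [hk, pow_mul, rot_pow_self, one_pow]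
      rw [h1, inv_one, one_mul, mul_one]
      exact commute_conj_rot_threeCycle h5 (by omega)
    · rw [if_pos rfl, ← commutator_threeCycles]
      congr 1
      group
    · have h2 := len_add_five_le h
      rw [if_neg h.ne', commutatorElement_eq_one_iff_commute]
      obtain ⟨j, hj⟩ := Nat.exists_eq_add_of_le (Nat.le_of_add_right_le h2)
      have e : (rot (arity n) ^ len N)⁻¹ *
          (rot (arity n) ^ len n * (swap 3 2 * swap 2 5) * (rot (arity n) ^ len n)⁻¹) *
          rot (arity n) ^ len N = rot (arity n) ^ j * (swap 3 2 * swap 2 5) *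
            (rot (arity n) ^ j)⁻¹ := by
        rw [hj, pow_add]
        group
      rw [e]
      exact commute_conj_rot_threeCycle (by omega) (by omega)
  have key' := congrArg (blk (deg n)) key
  rw [commutatorElement_def] at key'
  simp only [map_mul, map_inv, map_pow] at key'
  simp only [Subgroup.coe_mul, Subgroup.coe_inv, Subgroup.coe_pow, Pi.mul_apply, Pi.inv_apply,
    Pi.pow_apply, genRot, genFst, genSnd, map_mul, map_inv, map_pow]
  rw [key']
  split_ifs with h
  · subst h
    simp
  · rw [map_one, Pi.mulSingle_eq_of_ne h]

theorem blk_mem_single {n : ℕ} {p : Perm ℕ} (hp : p ∈ altNat (arity n + 1)) (h0 : p 0 = 0) :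
    blk (deg n) p ∈ single n := by
  have har := arity_eq n
  obtain ⟨e, he, rfl⟩ := exists_eq_sh hp h0
  refine Subgroup.mem_comap.1
    (sh_mem_of_consecutive (K := (single n).comap (blk (deg n))) (by omega) ?_ he)
  intro i hi him
  have h1 := conj_mem_single (pow_mem genRot_mem (i - 1)) (blk_threeCycle_mem_single n)
  have h2 : (genRot ^ (i - 1)).1 n = blk (deg n) (rot (arity n) ^ (i - 1)) := by
    rw [map_pow]
    rfl
  rw [h2, ← map_inv, ← map_mul, ← map_mul, conj_threeCycle, rot_pow_apply (by omega) (by omega),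
    rot_pow_apply (by omega) (by omega), rot_pow_apply (by omega) (by omega)] at h1
  rw [Subgroup.mem_comap]
  convert h1 using 4 <;> omega

theorem cp_mem_single {n d : ℕ} {a : Perm ℕ} (ha : a ∈ grp n) (hd : 1 ≤ d) (hdm : d ≤ arity n) :
    cp (deg n) d a ∈ single n := by
  have har := arity_eq n
  obtain ⟨f, _, hf, _, hu, hfA, hf1⟩ := (exists_lister n).choose_spec
  refine cp_mem_of_normalized (deg_pos n) (by omega) (grp_le_supp n) (grp_le_commutator n) ?_
    (fun w hw => conj_mem_single genList_mem hw) hf hu hfA hf1 ha hd hdm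
  intro i j k hi hj hk him hjm hkm hij hjk hik
  exact blk_mem_single (threeCycle_mem_altNat hi hj hk him hjm hkm hij hjk)
    ((threeCycle_apply hij hjk hik).2.2.2 0 (by omega) (by omega) (by omega))

/-- The finitely generated group that will turn out to be the stabilizer of the first block. -/
noncomputable def stab : Subgroup (Perm ℕ) := famGrp.map glue ⊔ grp 1

theorem fg_stab : stab.FG := by
  refine (Subgroup.fg_iff _).2
    ⟨glue '' {genRot, genFst, genSnd, genList} ∪ (grp 1 : Set (Perm ℕ)), ?_, ?_⟩
  · rw [Subgroup.closure_union, Subgroup.closure_eq, ← MonoidHom.map_closure]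
    rfl
  · exact ((Set.toFinite _).image _).union (finite_grp 1)

theorem single_le_stab (n : ℕ) : single n ≤ stab := fun _ hw =>
  Subgroup.mem_sup_left (glue_mem_of_mem_single hw)

/-- The permutations agreeing with an element of `grp n` on the initial segment. -/
def agree (n : ℕ) : Subgroup (Perm ℕ) where
  carrier := {h | ∃ a ∈ grp n, ∀ z, z < deg n → h z = a z}
  one_mem' := ⟨1, one_mem _, fun _ _ => rfl⟩
  mul_mem' := by
    rintro h h' ⟨a, ha, e⟩ ⟨a', ha', e'⟩
    refine ⟨a * a', mul_mem ha ha', fun z hz => ?_⟩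
    rw [Perm.mul_apply, e' z hz, e _ (apply_lt_of_mem_supp (grp_le_supp n ha') hz),
      Perm.mul_apply]
  inv_mem' := by
    rintro h ⟨a, ha, e⟩
    refine ⟨a⁻¹, inv_mem ha, fun z hz => ?_⟩
    rw [Perm.inv_eq_iff_eq, e _ (apply_lt_of_mem_supp (grp_le_supp n (inv_mem ha)) hz)]
    exact (a.apply_symm_apply z).symm

theorem apply_lt_of_mem_agree {n z : ℕ} {h : Perm ℕ} (hh : h ∈ agree n) (hz : z < deg n) :
    h z < deg n := by
  obtain ⟨a, ha, e⟩ := hh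
  rw [e z hz]
  exact apply_lt_of_mem_supp (grp_le_supp n ha) hz

theorem le_apply_of_mem_agree {n z : ℕ} {h : Perm ℕ} (hh : h ∈ agree n) (hz : deg n ≤ z) :
    deg n ≤ h z := by
  by_contra hlt
  have := apply_lt_of_mem_agree (inv_mem hh) (not_le.1 hlt)
  rw [show h⁻¹ (h z) = z from h.symm_apply_apply z] at this
  omega

theorem grp_le_agree {k n : ℕ} (hk : k ≤ n) : grp k ≤ agree n := fun a ha =>
  ⟨a, grp_mono hk ha, fun _ _ => rfl⟩

theorem stab_le_agree (n : ℕ) : stab ≤ agree (n + 1) := by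
  refine sup_le ?_ (grp_le_agree (by omega))
  rintro _ ⟨g, _, rfl⟩
  exact exists_eqOn_glue g (n + 1)

theorem conj_mem_grp_of_mem_agree {n : ℕ} {h e : Perm ℕ} (hh : h ∈ agree n) (he : e ∈ grp n) :
    h * e * h⁻¹ ∈ grp n := by
  have hh' := hh
  obtain ⟨a, ha, hag⟩ := hh
  have hc : a * e * a⁻¹ ∈ grp n := mul_mem (mul_mem ha he) (inv_mem ha)
  have : h * e * h⁻¹ = a * e * a⁻¹ := by
    rw [mul_inv_eq_iff_eq_mul]
    ext z
    rw [Perm.mul_apply, Perm.mul_apply]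
    by_cases hz : z < deg n
    · rw [hag _ (apply_lt_of_mem_supp (grp_le_supp n he) hz), hag z hz]
      simp
    · rw [grp_le_supp n he z (not_lt.1 hz),
        grp_le_supp n hc _ (le_apply_of_mem_agree hh' (not_lt.1 hz))]
  rwa [this]

/-- The group generated by `stab` and all iterated wreath products. -/
def bigGrp : Subgroup (Perm ℕ) where
  carrier := {g | ∃ h ∈ stab, ∃ n, ∃ e ∈ grp (n + 1), g = h * e}
  one_mem' := ⟨1, one_mem _, 0, 1, one_mem _, by simp⟩
  mul_mem' := by
    rintro _ _ ⟨h, hh, n, e, he, rfl⟩ ⟨h', hh', n', e', he', rfl⟩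
    have h1 := conj_mem_grp_of_mem_agree (inv_mem (stab_le_agree n hh')) he
    refine ⟨h * h', mul_mem hh hh', max n n', h'⁻¹ * e * h'⁻¹⁻¹ * e', mul_mem ?_ ?_, by group⟩
    · exact grp_mono (by omega) h1
    · exact grp_mono (by omega) he'
  inv_mem' := by
    rintro _ ⟨h, hh, n, e, he, rfl⟩
    exact ⟨h⁻¹, inv_mem hh, n, h * e⁻¹ * h⁻¹,
      conj_mem_grp_of_mem_agree (stab_le_agree n hh) (inv_mem he), by group⟩

theorem stab_le_bigGrp : stab ≤ bigGrp := fun h hh => ⟨h, hh, 0, 1, one_mem _, by simp⟩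

theorem grp_le_bigGrp (n : ℕ) : grp n ≤ bigGrp := fun e he =>
  ⟨1, one_mem _, n, e, grp_mono n.le_succ he, by simp⟩

theorem countable_of_fg {G : Type*} [Group G] {H : Subgroup G} (hH : H.FG) : Countable H := by
  obtain ⟨S, _, φ, hφ⟩ := Group.fg_iff_exists_freeGroup_hom_surjective_finite.1
    ((Group.fg_iff_subgroup_fg H).2 hH)
  have : Countable (FreeGroup S) := Function.Surjective.countable (f := FreeGroup.mk)
    Quot.mk_surjective
  exact hφ.countable

theorem countable_bigGrp : Countable bigGrp := by
  have := countable_of_fg fg_stab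
  let Φ : stab × (Σ n, grp (n + 1)) → bigGrp := fun x =>
    ⟨x.1.1 * x.2.2.1, x.1.1, x.1.2, x.2.1, x.2.2.1, x.2.2.2, rfl⟩
  refine Function.Surjective.countable (f := Φ) ?_
  rintro ⟨_, h, hh, n, e, he, rfl⟩
  exact ⟨⟨⟨h, hh⟩, n, ⟨e, he⟩⟩, rfl⟩

theorem exists_mem_altNat_apply {r a b : ℕ} (hr : 3 ≤ r) (ha : a < r) (hb : b < r) :
    ∃ p ∈ altNat r, p a = b := by
  by_cases hab : a = b
  · exact ⟨1, one_mem _, hab⟩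
  obtain ⟨c, hc, hca, hcb⟩ : ∃ c < r, c ≠ a ∧ c ≠ b := by
    by_contra! h
    have h0 := h 0
    have h1 := h 1
    have h2 := h 2
    omega
  have hab' : (⟨a, ha⟩ : Fin r) ≠ ⟨b, hb⟩ := by simpa using hab
  have hbc' : (⟨b, hb⟩ : Fin r) ≠ ⟨c, hc⟩ := by simpa using hcb.symm
  have hac' : (⟨a, ha⟩ : Fin r) ≠ ⟨c, hc⟩ := by simpa using hca.symm
  refine ⟨_, mem_altNat_fin (swap ⟨a, ha⟩ ⟨b, hb⟩ * swap ⟨b, hb⟩ ⟨c, hc⟩) ?_, ?_⟩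
  · rw [map_mul, Perm.sign_swap hab', Perm.sign_swap hbc']
    rfl
  · have := Perm.viaEmbedding_apply (swap ⟨a, ha⟩ ⟨b, hb⟩ * swap ⟨b, hb⟩ ⟨c, hc⟩)
      Fin.valEmbedding ⟨a, ha⟩
    rw [Perm.mul_apply, swap_apply_of_ne_of_ne hab' hac', swap_apply_left] at this
    exact this

theorem not_fg_bigGrp : ¬ Group.FG bigGrp := by
  rw [Group.fg_iff_subgroup_fg, Subgroup.fg_iff]
  rintro ⟨S, hS, hfin⟩
  have hloc : ∀ g ∈ bigGrp, ∃ n, ∀ k, n ≤ k → g ∈ agree (k + 1) := by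
    rintro _ ⟨h, hh, n, e, he, rfl⟩
    exact ⟨n, fun k hk => mul_mem (stab_le_agree k hh) (grp_le_agree (by omega) he)⟩
  obtain ⟨N, hN⟩ : ∃ N, ∀ g ∈ S, ∀ k, N ≤ k → g ∈ agree (k + 1) := by
    have hSb : ∀ g ∈ S, g ∈ bigGrp := fun g hg => hS ▸ Subgroup.subset_closure hg
    clear hS
    induction S, hfin using Set.Finite.induction_on with
    | empty => exact ⟨0, by simp⟩
    | insert _ _ ih =>
      obtain ⟨N, hN⟩ := ih fun g hg => hSb g (Set.mem_insert_of_mem _ hg)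
      obtain ⟨n, hn⟩ := hloc _ (hSb _ (Set.mem_insert _ _))
      refine ⟨max N n, fun g hg k hk => ?_⟩
      rcases Set.mem_insert_iff.1 hg with rfl | hg
      · exact hn k (by omega)
      · exact hN g hg k (by omega)
  have hle : bigGrp ≤ agree (N + 1) := by
    rw [← hS, Subgroup.closure_le]
    exact fun g hg => hN g hg N le_rfl
  have har := arity_eq (N + 1)
  obtain ⟨p, hp, hp0⟩ := exists_mem_altNat_apply (r := arity (N + 1) + 1) (a := 0) (b := 1)
    (by omega) (by omega) (by omega)
  have h1 := apply_lt_of_mem_agree (hle (grp_le_bigGrp _ (blk_mem_grp hp))) (deg_pos (N + 1))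
  have h2 := blk_block p 0 (deg_pos (N + 1))
  rw [mul_zero, zero_add, hp0] at h2
  omega

theorem mem_stab_of_mem_grp {n : ℕ} {e : Perm ℕ} (he : e ∈ grp n) (h0 : e 0 < deg 1) :
    e ∈ stab := by
  induction n generalizing e with
  | zero =>
    rw [grp_zero, Subgroup.mem_bot] at he
    rw [he]
    exact one_mem _
  | succ n ih =>
    rcases Nat.eq_zero_or_pos n with rfl | hn
    · exact Subgroup.mem_sup_right he
    have hdeg : deg 1 ≤ deg n := deg_strictMono.monotone hn
    rw [grp_succ] at he
    obtain ⟨p, hp, f, hf, hf', h⟩ := exists_normalForm (grp_le_supp n) he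
    have h1 := h 0 0 (deg_pos n)
    rw [mul_zero, zero_add] at h1
    have hp0 : p 0 = 0 := by
      by_contra hne
      have := Nat.pos_of_ne_zero hne
      nlinarith
    rw [hp0, mul_zero, zero_add] at h1
    refine mem_of_normalForm (deg_pos n) (grp_le_supp n) hf hf' h
      (single_le_stab n (blk_mem_single hp hp0)) fun d hd => ?_
    rcases Nat.eq_zero_or_pos d with rfl | hd0
    · rw [cp_zero]
      exact ih (hf 0) (by omega)
    · exact single_le_stab n (cp_mem_single (hf d) hd0 (by omega))

theorem mem_stab_of_mem_bigGrp {g : Perm ℕ} (hg : g ∈ bigGrp) (h0 : g 0 < deg 1) : g ∈ stab := by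
  obtain ⟨h, hh, n, e, he, rfl⟩ := hg
  refine mul_mem hh (mem_stab_of_mem_grp he ?_)
  have := apply_lt_of_mem_agree (inv_mem (stab_le_agree 0 hh)) h0
  rwa [Perm.mul_apply, show h⁻¹ (h (e 0)) = e 0 from h.symm_apply_apply _] at this

/-- The permutations preserving the partition into consecutive blocks of length `R`. -/
def blockPres (R : ℕ) : Subgroup (Perm ℕ) where
  carrier := {g | ∀ z w, g z / R = g w / R ↔ z / R = w / R}
  one_mem' := fun _ _ => Iff.rfl
  mul_mem' := fun hg hh z w => (hg _ _).trans (hh z w)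
  inv_mem' := by
    intro g hg z w
    have := hg (g⁻¹ z) (g⁻¹ w)
    rw [show g (g⁻¹ z) = z from g.apply_symm_apply z,
      show g (g⁻¹ w) = w from g.apply_symm_apply w] at this
    exact this.symm

theorem blk_mem_blockPres {R M : ℕ} (hR : 0 < R) (h : R ∣ M) (p : Perm ℕ) :
    blk M p ∈ blockPres R := by
  obtain ⟨k, rfl⟩ := h
  have key : ∀ z, blk (R * k) p z / R = blk k p (z / R) := by
    intro z
    rw [blk_apply, blk_apply, mul_assoc, Nat.mul_add_div hR, Nat.mod_mul_right_div_self,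
      Nat.div_div_eq_div_mul]
  intro z w
  rw [key, key]
  exact (blk k p).injective.eq_iff

theorem supp_le_blockPres (R : ℕ) : supp R ≤ blockPres R := by
  have key : ∀ g ∈ supp R, ∀ z, g z / R = z / R := by
    intro g hg z
    by_cases hz : z < R
    · rw [Nat.div_eq_of_lt hz, Nat.div_eq_of_lt (apply_lt_of_mem_supp hg hz)]
    · rw [hg z (not_lt.1 hz)]
  intro g hg z w
  rw [key g hg, key g hg]

theorem deg_one_dvd (n : ℕ) : deg 1 ∣ deg (n + 1) := by
  induction n with
  | zero => exact dvd_rfl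
  | succ n ih =>
    rw [deg_succ]
    exact ih.mul_right _

theorem grp_le_blockPres (n : ℕ) : grp (n + 1) ≤ blockPres (deg 1) := by
  induction n with
  | zero => exact (grp_le_supp 1).trans (supp_le_blockPres _)
  | succ n ih =>
    have hblk := blk_mem_blockPres (deg_pos 1) (deg_one_dvd n)
    rw [grp_succ]
    refine wreath_le (fun p _ => hblk p) fun d _ a ha => ?_
    rw [cp, MulAut.conj_apply]
    exact mul_mem (mul_mem (hblk _) (ih ha)) (inv_mem (hblk _))

theorem bigGrp_le_blockPres : bigGrp ≤ blockPres (deg 1) := by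
  rintro _ ⟨h, hh, n, e, he, rfl⟩
  refine mul_mem ?_ (grp_le_blockPres n he)
  intro z w
  obtain ⟨a, ha, hag⟩ := stab_le_agree (max z w) hh
  have := deg_strictMono.le_apply (x := max z w + 1)
  rw [hag z (by omega), hag w (by omega)]
  exact grp_le_blockPres _ ha z w

theorem altNat_le_grp_one : altNat (deg 1) ≤ grp 1 := by
  intro p hp
  rw [deg_succ, deg_zero, one_mul] at hp
  have h1 := blk_mem_grp hp
  have h2 : blk (deg 0) p = p := by
    ext z
    simp [blk_apply, deg_zero, Nat.mod_one]
  rwa [h2] at h1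

/-- The action of the stabilizer on the first block. -/
noncomputable def stabAction : stab.subgroupOf bigGrp →* Perm (Fin (deg 1)) :=
  MonoidHom.toHomPerm
    { toFun := fun h z => ⟨h.1.1 z, apply_lt_of_mem_agree (stab_le_agree 0 h.2) z.2⟩
      map_one' := rfl
      map_mul' := fun _ _ => rfl }

theorem exists_stabAction_apply_eq (a b : Fin (deg 1)) :
    ∃ β : stab.subgroupOf bigGrp, stabAction β a = b ∧ ∀ t : bigGrp, t ∉ stab.subgroupOf bigGrp →
      ∃ h : t⁻¹ * β * t ∈ stab.subgroupOf bigGrp, stabAction ⟨_, h⟩ = 1 := by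
  have hdeg : 3 ≤ deg 1 := by
    rw [deg_succ, deg_zero, arity_eq]
    omega
  obtain ⟨p, hp, hpa⟩ := exists_mem_altNat_apply hdeg a.2 b.2
  have hps : p ∈ stab := Subgroup.mem_sup_right (altNat_le_grp_one hp)
  refine ⟨⟨⟨p, stab_le_bigGrp hps⟩, hps⟩, Fin.ext hpa, fun t ht => ?_⟩
  have ht0 : deg 1 ≤ t.1 0 := by
    by_contra h
    exact ht (mem_stab_of_mem_bigGrp t.2 (not_le.1 h))
  have hfix : ∀ z, z < deg 1 → (t.1⁻¹ * p * t.1) z = z := by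
    intro z hz
    have h1 : t.1 z / deg 1 = t.1 0 / deg 1 :=
      (bigGrp_le_blockPres t.2 z 0).2 (by rw [Nat.div_eq_of_lt hz, Nat.zero_div])
    have h2 : deg 1 ≤ t.1 z := by
      by_contra h
      rw [Nat.div_eq_of_lt (not_le.1 h)] at h1
      have := Nat.div_pos ht0 (deg_pos 1)
      omega
    rw [Perm.mul_apply, Perm.mul_apply, altNat_le_supp _ hp _ h2]
    exact t.1.symm_apply_apply z
  have hmem : t⁻¹ * ⟨p, stab_le_bigGrp hps⟩ * t ∈ stab.subgroupOf bigGrp := by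
    rw [Subgroup.mem_subgroupOf]
    refine mem_stab_of_mem_bigGrp (SetLike.coe_mem _) ?_
    have := hfix 0 (deg_pos 1)
    exact this.trans_lt (deg_pos 1)
  refine ⟨hmem, ?_⟩
  ext z
  exact hfix z z.2

theorem fg_subgroupOf_of_le {G : Type*} [Group G] {H K : Subgroup G} (hHK : H ≤ K) (hH : H.FG) :
    (H.subgroupOf K).FG := by
  rw [← Group.fg_iff_subgroup_fg] at hH ⊢
  exact Group.fg_of_surjective (Subgroup.subgroupOfEquivOfLe hHK).symm.surjective
    (f := (Subgroup.subgroupOfEquivOfLe hHK).symm.toMonoidHom)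

end BlockTower

open BlockTower

/-- There exists a countable group `G` that is not finitely
generated, together with a finite alphabet `A` and an infinite minimal sofic
subshift over `G`. -/
theorem exists_nonFG_group_with_infinite_minimal_sofic_shift :
    ∃ (G : Type) (_ : Group G) (_ : Countable G), ¬ Group.FG G ∧
      ∃ (A : Type) (_ : Fintype A) (_ : TopologicalSpace A) (_ : DiscreteTopology A)
        (X : Set (G → A)),
        IsSoficShift G A X ∧ IsMinimalSubshift G A X ∧ X.Infinite := by
  have : Nontrivial (Fin (deg 1)) := by
    rw [Fin.nontrivial_iff_two_le, deg_succ, deg_zero, arity_eq]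
    omega
  exact ⟨bigGrp, inferInstance, countable_bigGrp, not_fg_bigGrp,
    exists_of_fg_subgroup not_fg_bigGrp (fg_subgroupOf_of_le stab_le_bigGrp fg_stab) stabAction
      exists_stabAction_apply_eq⟩
end

section
/- If an action of a group G on Cantor space Ω is antidiagonally minimal, then for every index set I the diagonal G-action on the set of injective functions I → Ω (viewed as a subspace of Ω^I with the product topology) is minimal, i.e., every orbit is dense in that subspace. -/
set_option synthInstance.maxHeartbeats 1000000
set_option maxHeartbeats 1000000

/-- An action of `G` on Cantor space `ℕ → Bool` is antidiagonally minimal if for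
every `n ≥ 1`, every orbit of the diagonal action on the antidiagonal
`{(x_1, …, x_n) : pairwise distinct}` of `(ℕ → Bool)^n` is dense in the
antidiagonal. -/
def AntidiagonallyMinimal (G : Type*) [Group G] [MulAction G (ℕ → Bool)] : Prop :=
  ∀ n : ℕ, 1 ≤ n → ∀ x : Fin n → ℕ → Bool, Function.Injective x →
    {y : Fin n → ℕ → Bool | Function.Injective y} ⊆
      closure {y : Fin n → ℕ → Bool | ∃ g : G, y = fun i => g • x i}

/-- If an action of `G` on Cantor space is antidiagonally minimal,
then for every index set `I`, every orbit of the diagonal `G`-action on the set of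
injective functions `I → Ω` (with the subspace topology from `Ω^I`) is dense in
that subspace. -/
theorem antidiagonallyMinimal_all_cardinals (G : Type*) [Group G]
    [MulAction G (ℕ → Bool)] (h : AntidiagonallyMinimal G) :
    ∀ (I : Type*) (x : I → ℕ → Bool), Function.Injective x →
      {y : I → ℕ → Bool | Function.Injective y} ⊆
        closure {y : I → ℕ → Bool | ∃ g : G, y = fun i => g • x i} := by
  intro I x hx y hy
  rw [mem_closure_iff]
  intro o ho hyo
  obtain ⟨F, u, hu, hFo⟩ := isOpen_pi_iff.1 ho y hyo
  obtain rfl | hF := F.eq_empty_or_nonempty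
  · exact ⟨fun i => (1 : G) • x i, hFo (by simp), 1, rfl⟩
  · let e : Fin F.card → I := fun k => F.equivFin.symm k
    have he : Function.Injective e := Subtype.val_injective.comp F.equivFin.symm.injective
    obtain ⟨_, hzu, g, rfl⟩ := mem_closure_iff.1
      (h F.card hF.card_pos (x ∘ e) (hx.comp he) (hy.comp he : Function.Injective (y ∘ e)))
      (Set.univ.pi fun k => u (e k))
      (isOpen_set_pi Set.finite_univ fun k _ => (hu _ (F.equivFin.symm k).2).1)
      (fun k _ => (hu _ (F.equivFin.symm k).2).2)
    refine ⟨fun i => g • x i, hFo fun i hi => ?_, g, rfl⟩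
    simpa [e] using hzu (F.equivFin ⟨i, hi⟩) (Set.mem_univ _)
end

section
/- The natural action of Thompson's group V on Cantor space {0,1}^ℕ is antidiagonally minimal. -/
/-- Prepend a finite binary word `u` to an infinite binary sequence `x`. -/
def seqAppend (u : List Bool) (x : ℕ → Bool) : ℕ → Bool :=
  fun n => if n < u.length then u.getD n false else x (n - u.length)

/-- A finite set `U` of finite binary words is a complete prefix code if every
point of Cantor space `ℕ → Bool` has a unique prefix in `U`, i.e. the cylinders
`[u]`, `u ∈ U`, partition Cantor space. -/
def IsCompletePrefixCode (U : Finset (List Bool)) : Prop :=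
  ∀ x : ℕ → Bool, ∃! u : List Bool, u ∈ U ∧ ∃ y : ℕ → Bool, x = seqAppend u y

/-- Membership in Thompson's group `V`, viewed inside the permutations of Cantor
space: `f` is of the form `f_φ` for a bijection `φ : A → B` between two complete
prefix codes, replacing the unique prefix in `A` by its `φ`-image. (Any such map
is automatically a homeomorphism.) -/
def InThompsonV (f : Equiv.Perm (ℕ → Bool)) : Prop :=
  ∃ (A B : Finset (List Bool)) (_ : IsCompletePrefixCode A)
    (_ : IsCompletePrefixCode B) (e : {u // u ∈ A} ≃ {v // v ∈ B}),
    ∀ (u : {u // u ∈ A}) (x : ℕ → Bool), f (seqAppend u.1 x) = seqAppend (e u).1 x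

open Filter Topology

theorem seqAppend_ofFn {N : ℕ} (w : Fin N → Bool) (z : ℕ → Bool) (n : ℕ) :
    seqAppend (List.ofFn w) z n = if h : n < N then w ⟨n, h⟩ else z (n - N) := by
  by_cases h : n < N <;> simp [seqAppend, h]

/-- The finite set of all binary words of length `N`. -/
def wordsOfLength (N : ℕ) : Finset (List Bool) :=
  Finset.univ.image (List.ofFn : (Fin N → Bool) → List Bool)

theorem isCompletePrefixCode_wordsOfLength (N : ℕ) :
    IsCompletePrefixCode (wordsOfLength N) := by
  intro x
  refine ⟨List.ofFn fun i : Fin N => x i, ⟨by simp [wordsOfLength], fun n => x (n + N), ?_⟩, ?_⟩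
  · ext1 n
    rw [seqAppend_ofFn]
    split_ifs with h
    · rfl
    · rw [Nat.sub_add_cancel (not_lt.1 h)]
  · rintro u ⟨hu, y, rfl⟩
    obtain ⟨w, -, rfl⟩ := Finset.mem_image.1 hu
    congr 1
    ext1 i
    rw [seqAppend_ofFn, dif_pos i.2]

/-- Functions `Fin N → Bool` enumerate the binary words of length `N`. -/
noncomputable def wordEquiv (N : ℕ) : (Fin N → Bool) ≃ {u // u ∈ wordsOfLength N} :=
  Equiv.ofBijective (fun w => ⟨List.ofFn w, by simp [wordsOfLength]⟩)
    ⟨fun _ _ h => List.ofFn_injective (congrArg Subtype.val h), fun ⟨u, hu⟩ => by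
      obtain ⟨w, -, rfl⟩ := Finset.mem_image.1 hu
      exact ⟨w, rfl⟩⟩

/-- Replace the prefix of length `N` of a sequence by its image under `σ`. -/
def prefixMap {N : ℕ} (σ : (Fin N → Bool) → Fin N → Bool) (x : ℕ → Bool) : ℕ → Bool :=
  fun n => if h : n < N then σ (fun i => x i) ⟨n, h⟩ else x n

theorem prefixMap_prefixMap {N : ℕ} (σ τ : (Fin N → Bool) → Fin N → Bool) (x : ℕ → Bool) :
    prefixMap σ (prefixMap τ x) = prefixMap (σ ∘ τ) x := by
  ext1 n
  by_cases h : n < N <;> simp [prefixMap, h]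

theorem prefixMap_id {N : ℕ} (x : ℕ → Bool) :
    prefixMap (id : (Fin N → Bool) → Fin N → Bool) x = x := by
  ext1 n
  simp [prefixMap]

/-- The permutation of Cantor space permuting prefixes of length `N` according to `σ`. -/
def prefixPerm {N : ℕ} (σ : Equiv.Perm (Fin N → Bool)) : Equiv.Perm (ℕ → Bool) where
  toFun := prefixMap σ
  invFun := prefixMap σ.symm
  left_inv x := by simp [prefixMap_prefixMap, prefixMap_id]
  right_inv x := by simp [prefixMap_prefixMap, prefixMap_id]

theorem inThompsonV_prefixPerm {N : ℕ} (σ : Equiv.Perm (Fin N → Bool)) :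
    InThompsonV (prefixPerm σ) := by
  refine ⟨_, _, isCompletePrefixCode_wordsOfLength N, isCompletePrefixCode_wordsOfLength N,
    (wordEquiv N).symm.trans (σ.trans (wordEquiv N)), fun u x => ?_⟩
  obtain ⟨w, rfl⟩ := (wordEquiv N).surjective u
  simp only [Equiv.trans_apply, Equiv.symm_apply_apply]
  change prefixMap σ (seqAppend (List.ofFn w) x) = seqAppend (List.ofFn (σ w)) x
  ext1 n
  by_cases h : n < N <;> simp [prefixMap, seqAppend_ofFn, h]

/-- The prefixes of sufficiently large length of finitely many distinct sequences are distinct. -/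
theorem eventually_prefixes_injective {ι : Type*} [Finite ι] {x : ι → ℕ → Bool}
    (hx : Function.Injective x) :
    ∀ᶠ N in atTop, Function.Injective fun i (k : Fin N) => x i k := by
  have key : ∀ i j, ∀ᶠ N in atTop, (fun k : Fin N => x i k) = (fun k : Fin N => x j k) → i = j := by
    intro i j
    by_cases hij : i = j
    · simp [hij]
    · obtain ⟨m, hm⟩ := Function.ne_iff.1 (hx.ne hij)
      filter_upwards [eventually_gt_atTop m] with N hN h
      exact absurd (congrFun h ⟨m, hN⟩) hm
  filter_upwards [eventually_all.2 fun i => eventually_all.2 (key i)] with N hN i j h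
  exact hN i j h

/-- Any injective tuple can be carried by a permutation to any other injective tuple of the same length. -/
theorem exists_perm_apply_eq {n : ℕ} {α : Type*} {a b : Fin n → α}
    (ha : Function.Injective a) (hb : Function.Injective b) :
    ∃ σ : Equiv.Perm α, ∀ i, σ (a i) = b i := by
  obtain ⟨σ, hσ⟩ := (Equiv.Perm.isMultiplyPretransitive α n).exists_smul_eq ⟨a, ha⟩ ⟨b, hb⟩
  exact ⟨σ, fun i => DFunLike.congr_fun hσ i⟩

/-- The natural action of Thompson's group `V` on Cantor space is
antidiagonally minimal: for every `n ≥ 1` and every injective `n`-tuple `x`, the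
`V`-orbit of `x` under the diagonal action is dense in the antidiagonal of
`(ℕ → Bool)^n`. -/
theorem thompsonV_antidiagonallyMinimal :
    ∀ n : ℕ, 1 ≤ n → ∀ x : Fin n → ℕ → Bool, Function.Injective x →
      {y : Fin n → ℕ → Bool | Function.Injective y} ⊆
        closure {y : Fin n → ℕ → Bool |
          ∃ f : Equiv.Perm (ℕ → Bool), InThompsonV f ∧ y = fun i => f (x i)} := by
  intro n _ x hx y hy
  have key : ∀ᶠ N in atTop, ∃ f : Equiv.Perm (ℕ → Bool), InThompsonV f ∧
      ∀ i, ∀ m < N, f (x i) m = y i m := by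
    filter_upwards [eventually_prefixes_injective hx, eventually_prefixes_injective hy] with N hxN hyN
    obtain ⟨σ, hσ⟩ := exists_perm_apply_eq hxN hyN
    refine ⟨prefixPerm σ, inThompsonV_prefixPerm σ, fun i m hm => ?_⟩
    change prefixMap σ (x i) m = y i m
    rw [prefixMap, dif_pos hm, hσ]
  obtain ⟨N₀, hN₀⟩ := eventually_atTop.1 key
  choose! f hf hfy using hN₀
  refine mem_closure_of_tendsto (f := fun N i => f N (x i)) (b := atTop) ?_ ?_
  · refine tendsto_pi_nhds.2 fun i => tendsto_pi_nhds.2 fun m => tendsto_nhds_of_eventually_eq ?_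
    filter_upwards [eventually_ge_atTop N₀, eventually_gt_atTop m] with N hN hm
    exact hfy N hN i m hm
  · filter_upwards [eventually_ge_atTop N₀] with N hN
    exact ⟨f N, hf N hN, rfl⟩
end

section
/- Thompson's group V contains a subgroup isomorphic to the free group on two generators. -/
theorem seqAppend_append (u v : List Bool) (x : ℕ → Bool) :
    seqAppend (u ++ v) x = seqAppend u (seqAppend v x) := by
  funext n
  simp only [seqAppend, List.length_append]
  by_cases hu : n < u.length
  · simp [hu, Nat.lt_add_right]
  · rw [if_neg hu, List.getD_append_right _ _ _ _ (by omega)]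
    by_cases hv : n < u.length + v.length
    · rw [if_pos hv, if_pos (by omega)]
    · rw [if_neg hv, if_neg (by omega), Nat.sub_add_eq]

theorem seqAppend_ofFn_s12 (N : ℕ) (x : ℕ → Bool) :
    seqAppend (List.ofFn fun i : Fin N => x i) (fun n => x (n + N)) = x := by
  funext n
  by_cases h : n < N
  · simp [seqAppend, h]
  · simp [seqAppend, h, Nat.sub_add_cancel (not_lt.mp h)]

theorem seqAppend_left_injective {u v : List Bool} (hl : u.length = v.length) {x y : ℕ → Bool}
    (h : seqAppend u x = seqAppend v y) : u = v := by
  refine List.ext_getElem hl fun n hu hv => ?_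
  simpa [seqAppend, hu, hv] using congrFun h n

/-- `f` acts on every word of length `N` as a prefix replacement. -/
def ReplacesPrefixes (f : (ℕ → Bool) → (ℕ → Bool)) (N : ℕ) : Prop :=
  ∀ u : List Bool, u.length = N → ∃ v : List Bool, ∀ x, f (seqAppend u x) = seqAppend v x

theorem ReplacesPrefixes.comp {f g : (ℕ → Bool) → (ℕ → Bool)} {N M : ℕ}
    (hf : ReplacesPrefixes f N) (hg : ReplacesPrefixes g M) :
    ReplacesPrefixes (f ∘ g) (M + N) := by
  intro u hu
  obtain ⟨v, hv⟩ := hg (u.take M) (by simp [hu])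
  set w := v ++ u.drop M with hw
  obtain ⟨t, ht⟩ := hf (w.take N) (by simp [hw, hu])
  refine ⟨t ++ w.drop N, fun x => ?_⟩
  calc f (g (seqAppend u x))
      = f (g (seqAppend (u.take M ++ u.drop M) x)) := by rw [List.take_append_drop]
    _ = f (seqAppend (w.take N ++ w.drop N) x) := by
        rw [seqAppend_append, hv, ← seqAppend_append, ← hw, List.take_append_drop]
    _ = seqAppend (t ++ w.drop N) x := by rw [seqAppend_append, ht, ← seqAppend_append]

theorem ReplacesPrefixes.inThompsonV {f : Equiv.Perm (ℕ → Bool)} {N : ℕ}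
    (hf : ReplacesPrefixes f N) : InThompsonV f := by
  choose! t ht using hf
  have hfin : {u : List Bool | u.length = N}.Finite := List.finite_length_eq Bool N
  have hmem : ∀ u, u ∈ hfin.toFinset ↔ u.length = N := by simp
  have hinj : ∀ u v : List Bool, u.length = N → v.length = N → ∀ x y,
      seqAppend (t u) x = seqAppend (t v) y → u = v := by
    intro u v hu hv x y h
    rw [← ht u hu, ← ht v hv] at h
    exact seqAppend_left_injective (hu.trans hv.symm) (f.injective h)
  refine ⟨hfin.toFinset, hfin.toFinset.image t, ?_, ?_, ?_, ?_⟩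
  · intro x
    refine ⟨List.ofFn fun i : Fin N => x i, ⟨by simp, _, (seqAppend_ofFn_s12 N x).symm⟩, ?_⟩
    rintro u ⟨hu, y, rfl⟩
    refine seqAppend_left_injective (y := fun n => seqAppend u y (n + N)) ?_
      (seqAppend_ofFn_s12 N _).symm
    simpa using hu
  · intro x
    have hx := seqAppend_ofFn_s12 N (f.symm x)
    set u := List.ofFn fun i : Fin N => f.symm x i with hu
    have hul : u.length = N := by simp [hu]
    rw [Equiv.eq_symm_apply, ht u hul] at hx
    refine ⟨t u, ⟨Finset.mem_image_of_mem t ((hmem u).2 hul), _, hx.symm⟩, ?_⟩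
    rintro v ⟨hv, y, hy⟩
    obtain ⟨w, hw, rfl⟩ := Finset.mem_image.1 hv
    rw [hinj w u ((hmem w).1 hw) hul _ _ (hy.symm.trans hx.symm)]
  · refine Equiv.ofBijective
      (fun u => ⟨t u.1, Finset.mem_image_of_mem t u.2⟩) ⟨fun u v h => ?_, fun v => ?_⟩
    · have h' : t u.1 = t v.1 := congrArg Subtype.val h
      exact Subtype.ext (hinj _ _ ((hmem _).1 u.2) ((hmem _).1 v.2) (fun _ => false)
        (fun _ => false) (by rw [h']))
    · obtain ⟨u, hu, huv⟩ := Finset.mem_image.1 v.2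
      exact ⟨⟨u, hu⟩, Subtype.ext huv⟩
  · intro u x
    exact ht u.1 ((hmem _).1 u.2) x

/-- The permutations of Cantor space that, together with their inverses, replace all prefixes of
some fixed length. -/
def prefixReplacementSubgroup : Subgroup (Equiv.Perm (ℕ → Bool)) where
  carrier := {f | (∃ N, ReplacesPrefixes f N) ∧ ∃ N, ReplacesPrefixes (f⁻¹ : Equiv.Perm _) N}
  one_mem' := by
    have h : ReplacesPrefixes (1 : Equiv.Perm (ℕ → Bool)) 0 := fun u _ => ⟨u, fun _ => rfl⟩
    exact ⟨⟨0, h⟩, 0, by simpa using h⟩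
  mul_mem' := by
    rintro f g ⟨⟨N, hf⟩, N', hf'⟩ ⟨⟨M, hg⟩, M', hg'⟩
    refine ⟨⟨M + N, hf.comp hg⟩, N' + M', ?_⟩
    rw [mul_inv_rev]
    exact hg'.comp hf'
  inv_mem' := by
    rintro f ⟨hf, hf'⟩
    exact ⟨hf', by simpa using hf⟩

/-- The replacement table, on words `cde`, of the map sending `bs ↦ bsb`, `b̄ ↦ bsb̄`,
`bs̄b ↦ bs̄`, `bs̄b̄ ↦ b̄`. -/
def pingPongWord (b s c d e : Bool) : List Bool :=
  if c ≠ b then [b, s, c, d, e] else if d = s then [b, s, b, e] else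
    if e = b then [b, d] else [e]

/-- The prefix replacement map mapping the complement of the cylinder `[bs̄]` onto `[bs]`. -/
def pingPongMap (b s : Bool) (x : ℕ → Bool) : ℕ → Bool :=
  seqAppend (pingPongWord b s (x 0) (x 1) (x 2)) fun n => x (n + 3)

theorem pingPongMap_seqAppend (b s c d e : Bool) (r : List Bool) (x : ℕ → Bool) :
    pingPongMap b s (seqAppend (c :: d :: e :: r) x) =
      seqAppend (pingPongWord b s c d e ++ r) x := by
  rw [seqAppend_append, pingPongMap]
  congr 1
  funext n
  simp [seqAppend]

theorem replacesPrefixes_pingPongMap (b s : Bool) : ReplacesPrefixes (pingPongMap b s) 3 := by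
  intro u hu
  obtain ⟨c, d, e, rfl⟩ := List.length_eq_three.1 hu
  exact ⟨_, pingPongMap_seqAppend b s c d e []⟩

theorem pingPongMap_not_pingPongMap (b s : Bool) (x : ℕ → Bool) :
    pingPongMap b (!s) (pingPongMap b s x) = x := by
  have key : ∀ (c d e p q : Bool) (y : ℕ → Bool),
      pingPongMap b (!s) (pingPongMap b s (seqAppend [c, d, e, p, q] y)) =
        seqAppend [c, d, e, p, q] y := by
    intro c d e p q y
    rw [pingPongMap_seqAppend]
    cases b <;> cases s <;> cases c <;> cases d <;> cases e <;>
      simp [pingPongWord, pingPongMap_seqAppend]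
  have hx := seqAppend_ofFn_s12 5 x
  simp only [List.ofFn_succ, List.ofFn_zero] at hx
  rw [← hx]
  exact key _ _ _ _ _ _

theorem pingPongMap_mem_cylinder (b s : Bool) (x : ℕ → Bool) (hx : ¬(x 0 = b ∧ x 1 = !s)) :
    pingPongMap b s x 0 = b ∧ pingPongMap b s x 1 = s := by
  unfold pingPongMap pingPongWord
  by_cases hb : x 0 = b
  · have hs : x 1 = s := by simpa [hb] using hx
    simp [hb, hs, seqAppend]
  · simp [hb, seqAppend]

/-- `pingPongMap b false` as a permutation, with inverse `pingPongMap b true`. -/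
def pingPongPerm (b : Bool) : Equiv.Perm (ℕ → Bool) where
  toFun := pingPongMap b false
  invFun := pingPongMap b true
  left_inv := pingPongMap_not_pingPongMap b false
  right_inv := pingPongMap_not_pingPongMap b true

theorem pingPongPerm_mem (b : Bool) : pingPongPerm b ∈ prefixReplacementSubgroup :=
  ⟨⟨3, replacesPrefixes_pingPongMap b false⟩, 3, replacesPrefixes_pingPongMap b true⟩

theorem injective_lift_pingPongPerm {ι : Type} [Nontrivial ι] {β : ι → Bool}
    (hβ : Function.Injective β) :
    Function.Injective (FreeGroup.lift fun i => pingPongPerm (β i)) := by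
  refine FreeGroup.injective_lift_of_ping_pong (fun i => pingPongPerm (β i))
    (fun i => {x : ℕ → Bool | x 0 = β i ∧ x 1 = false})
    (fun i => {x : ℕ → Bool | x 0 = β i ∧ x 1 = true}) ?_ ?_ ?_ ?_ ?_ ?_
  · exact fun i => ⟨seqAppend [β i] fun _ => false, rfl, rfl⟩
  · exact fun i j hij => Set.disjoint_left.2 fun x hi hj => hij (hβ (hi.1.symm.trans hj.1))
  · exact fun i j hij => Set.disjoint_left.2 fun x hi hj => hij (hβ (hi.1.symm.trans hj.1))
  · exact fun i j => Set.disjoint_left.2 fun x hi hj =>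
      Bool.false_ne_true (hi.2.symm.trans hj.2)
  · rintro i _ ⟨x, hx, rfl⟩
    exact pingPongMap_mem_cylinder (β i) false x hx
  · rintro i _ ⟨x, hx, rfl⟩
    exact pingPongMap_mem_cylinder (β i) true x hx

/-- Thompson's group `V` contains a subgroup isomorphic to the
free group on two generators: there is an injective homomorphism of `F₂` into the
permutations of Cantor space whose image consists of elements of `V`. -/
theorem thompsonV_contains_free_group :
    ∃ φ : FreeGroup (Fin 2) →* Equiv.Perm (ℕ → Bool),
      Function.Injective φ ∧ ∀ w : FreeGroup (Fin 2), InThompsonV (φ w) := by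
  have hβ : Function.Injective fun i : Fin 2 => i == 1 := by decide
  refine ⟨_, injective_lift_pingPongPerm hβ, fun w => ?_⟩
  have hrange := FreeGroup.range_lift_le (f := fun i : Fin 2 => pingPongPerm (i == 1))
    (s := prefixReplacementSubgroup) (Set.range_subset_iff.2 fun i => pingPongPerm_mem _)
  obtain ⟨⟨N, hN⟩, -⟩ := hrange ⟨w, rfl⟩
  exact hN.inThompsonV
end

section
/- Let a ∈ V be the homeomorphism defined by a(ix) = (1−i)x for i ∈ {0,1} and x ∈ {0,1}^ℕ, and let b ∈ V be the homeomorphism defined by b(0x) = 10x, b(10x) = 11x, b(11x) = 0x for all x ∈ {0,1}^ℕ. Then the subgroup of V generated by a and b is isomorphic to the free product (ℤ/2ℤ) * (ℤ/3ℤ), with a of order 2 and b of order 3. -/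
/-- If the homomorphism out of the indexed free product of two groups is injective, then so is the
corresponding homomorphism out of their binary free product. -/
theorem Monoid.Coprod.lift_injective_of_coprodI_lift_injective {F : Bool → Type*}
    [∀ i, Group (F i)] {G : Type*} [Group G] (φ : ∀ i, F i →* G)
    (hφ : Function.Injective (Monoid.CoprodI.lift φ)) :
    Function.Injective (Monoid.Coprod.lift (φ false) (φ true)) := by
  let toCoprodI : Monoid.Coprod (F false) (F true) →* Monoid.CoprodI F :=
    Monoid.Coprod.lift Monoid.CoprodI.of Monoid.CoprodI.of
  let incl : ∀ i, F i →* Monoid.Coprod (F false) (F true) :=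
    fun i => Bool.rec Monoid.Coprod.inl Monoid.Coprod.inr i
  have hleft : (Monoid.CoprodI.lift incl).comp toCoprodI = MonoidHom.id _ := by
    apply Monoid.Coprod.hom_ext <;> ext x <;> simp [toCoprodI, incl]
  have hlift : Monoid.Coprod.lift (φ false) (φ true) =
      (Monoid.CoprodI.lift φ).comp toCoprodI := by
    apply Monoid.Coprod.hom_ext <;> ext x <;> simp [toCoprodI]
  rw [hlift, MonoidHom.coe_comp]
  exact hφ.comp (Function.LeftInverse.injective fun x => DFunLike.congr_fun hleft x)

/-- The homomorphism from the cyclic group of order `n` sending the generator to an element `g`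
with `g ^ n = 1`. -/
def zmodPowHom {G : Type*} [Group G] (n : ℕ) (g : G) (hg : g ^ n = 1) :
    Multiplicative (ZMod n) →* G :=
  AddMonoidHom.toMultiplicativeLeft <| ZMod.lift n
    ⟨zmultiplesHom (Additive G) (Additive.ofMul g), by
      rw [zmultiplesHom_apply, natCast_zsmul, ← ofMul_pow, hg, ofMul_one]⟩

theorem zmodPowHom_ofAdd_intCast {G : Type*} [Group G] (n : ℕ) (g : G) (hg : g ^ n = 1) (k : ℤ) :
    zmodPowHom n g hg (Multiplicative.ofAdd (k : ZMod n)) = g ^ k := by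
  simp [zmodPowHom]

theorem range_zmodPowHom {G : Type*} [Group G] (n : ℕ) (g : G) (hg : g ^ n = 1) :
    (zmodPowHom n g hg).range = Subgroup.zpowers g := by
  ext x
  constructor
  · rintro ⟨y, rfl⟩
    obtain ⟨k, hk⟩ := ZMod.intCast_surjective y.toAdd
    refine ⟨k, ?_⟩
    change g ^ k = _
    rw [← zmodPowHom_ofAdd_intCast n g hg, hk, ofAdd_toAdd]
  · rintro ⟨k, rfl⟩
    exact ⟨_, zmodPowHom_ofAdd_intCast n g hg k⟩

theorem seqAppend_cons_apply_zero (i : Bool) (u : List Bool) (x : ℕ → Bool) :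
    seqAppend (i :: u) x 0 = i := by
  simp [seqAppend]

theorem eq_seqAppend_head (x : ℕ → Bool) : x = seqAppend [x 0] fun n => x (n + 1) := by
  funext n
  cases n <;> simp [seqAppend]

theorem eq_seqAppend_head_two (x : ℕ → Bool) :
    x = seqAppend [x 0, x 1] fun n => x (n + 2) := by
  funext n
  match n with
  | 0 | 1 | n + 2 => simp [seqAppend]

/-- Let `a ∈ V` be defined by `a(ix) = (1-i)x` for `i ∈ {0,1}`,
and `b ∈ V` by `b(0x) = 10x`, `b(10x) = 11x`, `b(11x) = 0x`. Then the subgroup of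
`V` generated by `a` and `b` is isomorphic to the free product `ℤ/2 * ℤ/3`, with
`a` of order `2` and `b` of order `3`. -/
theorem thompsonV_Z2_free_prod_Z3 (a b : Equiv.Perm (ℕ → Bool))
    (ha : ∀ (i : Bool) (x : ℕ → Bool), a (seqAppend [i] x) = seqAppend [!i] x)
    (hb0 : ∀ x : ℕ → Bool, b (seqAppend [false] x) = seqAppend [true, false] x)
    (hb10 : ∀ x : ℕ → Bool, b (seqAppend [true, false] x) = seqAppend [true, true] x)
    (hb11 : ∀ x : ℕ → Bool, b (seqAppend [true, true] x) = seqAppend [false] x) :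
    Nonempty ((Subgroup.closure {a, b} : Subgroup (Equiv.Perm (ℕ → Bool))) ≃*
        Monoid.Coprod (Multiplicative (ZMod 2)) (Multiplicative (ZMod 3))) ∧
      orderOf a = 2 ∧ orderOf b = 3 := by
  have ha2 : a ^ 2 = 1 := by
    ext1 x
    rw [eq_seqAppend_head x]
    simp [pow_two, ha]
  have hb3 : b ^ 3 = 1 := by
    ext1 x
    have hx := eq_seqAppend_head x
    have hx' := eq_seqAppend_head_two x
    cases h0 : x 0 <;> cases h1 : x 1 <;> rw [h0] at hx <;> rw [h0, h1] at hx'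
    · rw [hx]; simp [pow_succ, hb0, hb10, hb11]
    · rw [hx]; simp [pow_succ, hb0, hb10, hb11]
    · rw [hx']; simp [pow_succ, hb0, hb10, hb11]
    · rw [hx']; simp [pow_succ, hb0, hb10, hb11]
  have ha_maps : ∀ x, x 0 = true → a x 0 = false := by
    intro x hx
    rw [eq_seqAppend_head x, hx, ha]
    exact seqAppend_cons_apply_zero _ _ _
  have hb_maps : ∀ x, x 0 = false → b x 0 = true := by
    intro x hx
    rw [eq_seqAppend_head x, hx, hb0]
    exact seqAppend_cons_apply_zero _ _ _
  have hb2_maps : ∀ x, x 0 = false → (b ^ 2) x 0 = true := by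
    intro x hx
    rw [eq_seqAppend_head x, hx, pow_two, Equiv.Perm.mul_apply, hb0, hb10]
    exact seqAppend_cons_apply_zero _ _ _
  have hinj : Function.Injective
      (Monoid.Coprod.lift (zmodPowHom 2 a ha2) (zmodPowHom 3 b hb3)) := by
    let n : Bool → ℕ := fun i => bif i then 3 else 2
    let φ : ∀ i, Multiplicative (ZMod (n i)) →* Equiv.Perm (ℕ → Bool) :=
      fun i => Bool.rec (zmodPowHom 2 a ha2) (zmodPowHom 3 b hb3) i
    refine Monoid.Coprod.lift_injective_of_coprodI_lift_injective φ ?_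
    refine Monoid.CoprodI.lift_injective_of_ping_pong φ (Or.inr ⟨true, ?_⟩)
      (fun i => {x : ℕ → Bool | x 0 = i}) (fun i => ⟨fun _ => i, rfl⟩) ?_ ?_
    · change 3 ≤ Cardinal.mk (Fin 3)
      simp
    · exact fun i j hij => Set.disjoint_left.mpr fun x hx hx' => hij (hx.symm.trans hx')
    · rintro (_ | _) (_ | _) hij
      · exact absurd rfl hij
      · rintro (h : Multiplicative (ZMod 2)) (hne : h ≠ 1) _ ⟨x, hx, rfl⟩
        have hh : h = Multiplicative.ofAdd ((1 : ℤ) : ZMod 2) := by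
          revert h; decide
        change zmodPowHom 2 a ha2 h x 0 = false
        rw [hh, zmodPowHom_ofAdd_intCast, zpow_one]
        exact ha_maps x hx
      · rintro (h : Multiplicative (ZMod 3)) (hne : h ≠ 1) _ ⟨x, hx, rfl⟩
        have hh : h = Multiplicative.ofAdd ((1 : ℤ) : ZMod 3) ∨
            h = Multiplicative.ofAdd ((2 : ℤ) : ZMod 3) := by
          revert h; decide
        change zmodPowHom 3 b hb3 h x 0 = true
        rcases hh with hh | hh
        · rw [hh, zmodPowHom_ofAdd_intCast, zpow_one]
          exact hb_maps x hx
        · rw [hh, zmodPowHom_ofAdd_intCast]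
          exact hb2_maps x hx
      · exact absurd rfl hij
  have hrange : (Monoid.Coprod.lift (zmodPowHom 2 a ha2) (zmodPowHom 3 b hb3)).range =
      Subgroup.closure {a, b} := by
    rw [Monoid.Coprod.range_lift, range_zmodPowHom, range_zmodPowHom,
      Subgroup.zpowers_eq_closure, Subgroup.zpowers_eq_closure, ← Subgroup.closure_union,
      Set.singleton_union]
  refine ⟨⟨((MonoidHom.ofInjective hinj).trans (MulEquiv.subgroupCongr hrange)).symm⟩, ?_, ?_⟩
  · refine orderOf_eq_prime ha2 fun h => ?_
    simpa [h] using ha_maps (fun _ => true) rfl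
  · refine orderOf_eq_prime hb3 fun h => ?_
    simpa [h] using hb_maps (fun _ => false) rfl
end

section
/- Let K ≤ G be countable groups, let A be a finite alphabet, let X ⊆ A^K be a subshift defined by a set F of forbidden patterns (each with finite support contained in K), and let Y ⊆ A^G be the free extension of X, i.e., the subshift of A^G defined by the same set F of forbidden patterns. Fix a set R of left coset representatives of K in G with 1 ∈ R. Then the map Φ : Y → X^{G/K} defined by Φ(y)_{rK} = (r⁻¹·y)|K for r ∈ R is a well-defined G-equivariant homeomorphism from Y onto the induction of the K-system X to G. -/
set_option synthInstance.maxHeartbeats 1000000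
set_option maxHeartbeats 1000000

/-- The subshift of `A^K` defined by a set `F` of forbidden patterns (a pattern is
a finite support `q.1 : Finset K` together with values `q.2 : K → A` on it): the
configurations none of whose translates contains a forbidden pattern. -/
def patternSubshift (K : Type*) [Group K] (A : Type*)
    (F : Set (Finset K × (K → A))) : Set (K → A) :=
  {x : K → A | ∀ k : K, ∀ q ∈ F, ∃ d ∈ q.1, x (k⁻¹ * d) ≠ q.2 d}

/-- The free extension to `G` of the subshift of `A^K` (for `K ≤ G`) defined by a
set `F` of forbidden patterns with supports in `K`: the subshift of `A^G` defined
by the same forbidden patterns. -/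
def freeExtension {G : Type*} [Group G] (K : Subgroup G) (A : Type*)
    (F : Set (Finset K × (K → A))) : Set (G → A) :=
  {y : G → A | ∀ g : G, ∀ q ∈ F, ∃ d ∈ q.1, y (g⁻¹ * (d : G)) ≠ q.2 d}

/-- The induction to `G` of a `K`-action on a space `X` (here `X = K → A` with the
shift `K`-action), realized on `X^{G/K}` using the section `rep : G ⧸ K → G`
(whose range is the set `R` of left coset representatives): `(g * z)_{rK} = k • z_{tK}`
where `r = rep c`, `t ∈ R` and `k ∈ K` are determined by `r⁻¹ g = k t⁻¹`. -/
def inducedShiftAction {G : Type*} [Group G] (K : Subgroup G) (A : Type*)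
    (rep : G ⧸ K → G) (hrep : ∀ c : G ⧸ K, (QuotientGroup.mk (rep c) : G ⧸ K) = c)
    (g : G) (z : G ⧸ K → (K → A)) : G ⧸ K → (K → A) :=
  fun c =>
    let t : G ⧸ K := QuotientGroup.mk (g⁻¹ * rep c)
    let k : K := ⟨(rep c)⁻¹ * g * rep t, by
      have h1 : ((rep t : G) : G ⧸ K) = QuotientGroup.mk (g⁻¹ * rep c) := hrep t
      have h2 : (rep t)⁻¹ * (g⁻¹ * rep c) ∈ K := QuotientGroup.eq.mp h1
      have h3 := K.inv_mem h2
      simpa [mul_assoc, mul_inv_rev] using h3⟩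
    shiftAct K A k (z t)

/-- Restricting to the coset `rep c * K` undoes the gluing of configurations along cosets. -/
theorem glue_rep_mul {G : Type*} [Group G] (K : Subgroup G) {A : Type*}
    (rep : G ⧸ K → G) (hrep : ∀ c : G ⧸ K, (QuotientGroup.mk (rep c) : G ⧸ K) = c)
    (z : G ⧸ K → (K → A)) (c : G ⧸ K) (k : K) :
    z (QuotientGroup.mk (rep c * k))
        ⟨(rep (QuotientGroup.mk (rep c * k)))⁻¹ * (rep c * k),
          QuotientGroup.eq.mp (hrep (QuotientGroup.mk (rep c * k)))⟩ = z c k := by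
  have key : ∀ (c' : G ⧸ K) (h : (rep c')⁻¹ * (rep c * k) ∈ K), c' = c →
      z c' ⟨(rep c')⁻¹ * (rep c * k), h⟩ = z c k := by
    rintro c' h rfl
    congr 1
    ext
    simp
  exact key _ _ ((QuotientGroup.mk_mul_of_mem (rep c) k.2).trans (hrep c))

/-- Let `K ≤ G` be countable groups, `A` a finite alphabet, `X ⊆ A^K`
the subshift defined by a set `F` of forbidden patterns with supports in `K`, and
`Y ⊆ A^G` its free extension. Fix left coset representatives `R = rep '' (G ⧸ K)`
with `1 ∈ R`. Then `Φ(y)_{rK} = (r⁻¹ • y)|K` is a well-defined `G`-equivariant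
homeomorphism from `Y` onto the induction `{z : G ⧸ K → A^K | ∀ c, z c ∈ X}` of
the `K`-system `X` to `G` (with explicit continuous inverse `z ↦ (g ↦ z (gK) ((rep gK)⁻¹ g))`). -/
theorem freeExtension_homeomorphic_induction {G : Type*} [Group G] [Countable G]
    (K : Subgroup G) (A : Type*) [Fintype A] [TopologicalSpace A] [DiscreteTopology A]
    (F : Set (Finset K × (K → A)))
    (rep : G ⧸ K → G) (hrep : ∀ c : G ⧸ K, (QuotientGroup.mk (rep c) : G ⧸ K) = c)
    (hrep1 : rep (QuotientGroup.mk (1 : G)) = 1) :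
    Set.BijOn (fun (y : G → A) (c : G ⧸ K) (k : K) => y (rep c * k))
        (freeExtension K A F)
        {z : G ⧸ K → (K → A) | ∀ c : G ⧸ K, z c ∈ patternSubshift K A F} ∧
      ContinuousOn (fun (y : G → A) (c : G ⧸ K) (k : K) => y (rep c * k))
        (freeExtension K A F) ∧
      ContinuousOn (fun (z : G ⧸ K → (K → A)) (g : G) =>
          z (QuotientGroup.mk g)
            ⟨(rep (QuotientGroup.mk g))⁻¹ * g,
              QuotientGroup.eq.mp (hrep (QuotientGroup.mk g))⟩)
        {z : G ⧸ K → (K → A) | ∀ c : G ⧸ K, z c ∈ patternSubshift K A F} ∧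
      (∀ y ∈ freeExtension K A F,
        (fun (z : G ⧸ K → (K → A)) (g : G) =>
            z (QuotientGroup.mk g)
              ⟨(rep (QuotientGroup.mk g))⁻¹ * g,
                QuotientGroup.eq.mp (hrep (QuotientGroup.mk g))⟩)
          ((fun (y : G → A) (c : G ⧸ K) (k : K) => y (rep c * k)) y) = y) ∧
      (∀ y ∈ freeExtension K A F, ∀ g : G,
        (fun (c : G ⧸ K) (k : K) => shiftAct G A g y (rep c * k)) =
          inducedShiftAction K A rep hrep g
            (fun (c : G ⧸ K) (k : K) => y (rep c * k))) := by
  refine ⟨⟨?_, ?_, ?_⟩, ?_, ?_, ?_, ?_⟩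
  · intro y hy c k q hq
    obtain ⟨d, hd, hne⟩ := hy (k * (rep c)⁻¹) q hq
    exact ⟨d, hd, by simpa [mul_assoc] using hne⟩
  · intro y _ y' _ h
    ext g
    have hg := congrFun (congrFun h (QuotientGroup.mk g))
      ⟨(rep (QuotientGroup.mk g))⁻¹ * g, QuotientGroup.eq.mp (hrep (QuotientGroup.mk g))⟩
    simpa using hg
  · intro z hz
    refine ⟨fun g => z (QuotientGroup.mk g)
      ⟨(rep (QuotientGroup.mk g))⁻¹ * g, QuotientGroup.eq.mp (hrep (QuotientGroup.mk g))⟩,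
      ?_, funext₂ fun c k => glue_rep_mul K rep hrep z c k⟩
    intro g q hq
    let c : G ⧸ K := QuotientGroup.mk g⁻¹
    let k : K := ⟨(rep c)⁻¹ * g⁻¹, QuotientGroup.eq.mp (hrep c)⟩
    obtain ⟨d, hd, hne⟩ := hz c k⁻¹ q hq
    refine ⟨d, hd, ?_⟩
    rw [← glue_rep_mul K rep hrep z c] at hne
    have hg : rep c * ((k⁻¹⁻¹ * d : K) : G) = g⁻¹ * d := by simp [k, mul_assoc]
    simpa only [hg] using hne
  · fun_prop
  · fun_prop
  · intro y _
    ext g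
    simp
  · intro y _ g
    ext c k
    simp [inducedShiftAction, shiftAct, mul_assoc]
end
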